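/- (Theorem 2.10, (c) ⇒ (a)) Assume hypotheses (H1)–(H4). Suppose there exist constants β, τ ≥ 0, a lower semicontinuous V : [0,∞) × C([−r−τ,0]; ℝⁿ) → [0,∞), functions a₁, a₂ ∈ K∞ and a positive definite locally Lipschitz ρ : [0,∞) → [0,∞) such that: (1) a₁(|x(0)|) ≤ V(t,x) ≤ a₂(‖x‖_{r+τ}) for all (t,x) ∈ [0,∞) × C([−r−τ,0]; ℝⁿ); (2) V⁰(t, x; f(t, T_r(0)x, d)) ≤ β·V(t,x) for all (t,x,d) ∈ [0,∞) × C([−r−τ,0]; ℝⁿ) × D; (3) V⁰(t, x; f(t, T_r(0)x, d)) ≤ −ρ(V(t,x)) for all t ≥ τ, d ∈ D and x ∈ S(t). Then 0 ∈ C([−r,0]; ℝⁿ) is URGAS: there exists σ ∈ KL such that every maximal solution with data (t₀, x₀, d) ∈ [0,∞) × C([−r,0]; ℝⁿ) × M_D is defined on [t₀,∞) and satisfies ‖T_r(t)x‖_r ≤ σ(‖x₀‖_r, t−t₀) for all t ≥ t₀. -/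

import Mathlib

open Set Filter MeasureTheory
open scoped RealInnerProductSpace

noncomputable section

/-- ℝⁿ with the Euclidean norm. -/
abbrev Euc (n : ℕ) : Type := EuclideanSpace ℝ (Fin n)

/-- The sup norm `‖y‖_q = max_{θ ∈ [-q,0]} |y θ|` of a history segment. -/
def histNorm (n : ℕ) (q : ℝ) (y : ℝ → Euc n) : ℝ :=
  sSup ((fun θ => ‖y θ‖) '' Icc (-q) 0)

/-- The class `M_D` of allowed disturbances: right-continuous maps `d : [0,∞) → D`
which are continuous outside a countable set with no finite accumulation point. -/
def MD (l : ℕ) (D : Set (Euc l)) (d : ℝ → Euc l) : Prop :=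
  (∀ t, 0 ≤ t → d t ∈ D) ∧
  (∀ t, 0 ≤ t → ∀ ε > 0, ∃ δ > 0, ∀ s, t ≤ s → s - t < δ → ‖d s - d t‖ < ε) ∧
  ∃ A : Set ℝ, (∀ C : ℝ, (A ∩ Icc 0 C).Finite) ∧
    ∀ t, 0 ≤ t → t ∉ A → ∀ ε > 0, ∃ δ > 0, ∀ s, 0 ≤ s → |s - t| < δ → ‖d s - d t‖ < ε

/-- The operator `E_h(x;v)`. -/
def Eop (n : ℕ) (x : ℝ → Euc n) (h : ℝ) (v : Euc n) : ℝ → Euc n :=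
  fun θ => if -h < θ then x 0 + (θ + h) • v else x (θ + h)

/-- The generalized (Dini-type) derivative
`V⁰(t,x;v) = limsup_{h→0⁺, y→0} (V(t+h, E_h(x;v)+h y) - V(t,x))/h` of a functional `V`
defined on `[0,∞) × C([-q,0];ℝⁿ)`, with values in the extended reals. -/
def Vdot (n : ℕ) (q : ℝ) (V : ℝ → (ℝ → Euc n) → ℝ) (t : ℝ)
    (x : ℝ → Euc n) (v : Euc n) : EReal :=
  ⨅ δ : Ioi (0:ℝ), ⨆ p : {p : ℝ × (ℝ → Euc n) //
      0 < p.1 ∧ p.1 < (δ : ℝ) ∧ ContinuousOn p.2 (Icc (-q) 0) ∧ histNorm n q p.2 < (δ : ℝ)},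
    (((V (t + p.1.1) (fun θ => Eop n x p.1.1 v θ + p.1.1 • p.1.2 θ) - V t x) / p.1.1 : ℝ) : EReal)

/-- The upper right Dini derivative `D⁺v(t) = limsup_{h→0⁺} (v(t+h)-v(t))/h`. -/
def DiniUpper (v : ℝ → ℝ) (t : ℝ) : EReal :=
  Filter.limsup (fun h => (((v (t + h) - v t) / h : ℝ) : EReal)) (nhdsWithin 0 (Ioi 0))

/-- Class `K∞` functions (on `[0,∞)`). -/
def IsKInf (a : ℝ → ℝ) : Prop :=
  ContinuousOn a (Ici 0) ∧ StrictMonoOn a (Ici 0) ∧ a 0 = 0 ∧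
  (∀ s, 0 ≤ s → 0 ≤ a s) ∧ Filter.Tendsto a Filter.atTop Filter.atTop

/-- Class `K⁺`: positive continuous functions on `[0,∞)`. -/
def IsKPlus (b : ℝ → ℝ) : Prop :=
  ContinuousOn b (Ici 0) ∧ ∀ t, 0 ≤ t → 0 < b t

/-- Class `KL` functions. -/
def IsKL (σ : ℝ → ℝ → ℝ) : Prop :=
  ContinuousOn (fun p : ℝ × ℝ => σ p.1 p.2) (Ici 0 ×ˢ Ici 0) ∧
  (∀ s t, 0 ≤ s → 0 ≤ t → 0 ≤ σ s t) ∧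
  (∀ t, 0 ≤ t → StrictMonoOn (fun s => σ s t) (Ici 0) ∧ σ 0 t = 0) ∧
  (∀ s, 0 ≤ s → AntitoneOn (σ s) (Ici 0)) ∧
  (∀ s, 0 ≤ s → Filter.Tendsto (σ s) Filter.atTop (nhds 0))

/-- Hypothesis (H1): a one-sided Lipschitz estimate. -/
def H1 (n l : ℕ) (r : ℝ) (D : Set (Euc l)) (f : ℝ → (ℝ → Euc n) → Euc l → Euc n) : Prop :=
  ∃ L : ℝ → ℝ → ℝ,
    ContinuousOn (fun p : ℝ × ℝ => L p.1 p.2) (Ici 0 ×ˢ Ici 0) ∧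
    (∀ t, 0 ≤ t → MonotoneOn (L t) (Ici 0)) ∧
    (∀ s, 0 ≤ s → MonotoneOn (fun t => L t s) (Ici 0)) ∧
    (∀ t s, 0 ≤ t → 0 ≤ s → 0 ≤ L t s) ∧
    ∀ t x y d, 0 ≤ t → ContinuousOn x (Icc (-r) 0) → ContinuousOn y (Icc (-r) 0) → d ∈ D →
      (inner ℝ (x 0 - y 0) (f t x d - f t y d) : ℝ) ≤
        L t (histNorm n r x + histNorm n r y) * (histNorm n r (x - y))^2

/-- Hypothesis (H2): `f` maps bounded sets to bounded sets, uniformly in `d ∈ D`. -/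
def H2 (n l : ℕ) (r : ℝ) (D : Set (Euc l)) (f : ℝ → (ℝ → Euc n) → Euc l → Euc n) : Prop :=
  ∀ Tb Rb : ℝ, ∃ C : ℝ, ∀ t x d, 0 ≤ t → t ≤ Tb → ContinuousOn x (Icc (-r) 0) →
    histNorm n r x ≤ Rb → d ∈ D → ‖f t x d‖ ≤ C

/-- Hypothesis (H3): continuity off a countable exceptional set of times with no finite
accumulation point, plus right-continuity in time everywhere. -/
def H3 (n l : ℕ) (r : ℝ) (D : Set (Euc l)) (f : ℝ → (ℝ → Euc n) → Euc l → Euc n) : Prop :=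
  ∃ A : Set ℝ, (∀ C : ℝ, (A ∩ Icc 0 C).Finite) ∧
    (∀ t x d, 0 ≤ t → t ∉ A → ContinuousOn x (Icc (-r) 0) → d ∈ D →
      ∀ ε > 0, ∃ δ > 0, ∀ t' x' d', 0 ≤ t' → ContinuousOn x' (Icc (-r) 0) → d' ∈ D →
        |t' - t| < δ → histNorm n r (x' - x) < δ → ‖d' - d‖ < δ →
          ‖f t' x' d' - f t x d‖ < ε) ∧
    (∀ t x d, 0 ≤ t → ContinuousOn x (Icc (-r) 0) → d ∈ D →
      ∀ ε > 0, ∃ δ > 0, ∀ t', t ≤ t' → t' - t < δ → ‖f t' x d - f t x d‖ < ε)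

/-- Hypothesis (H4). -/
def H4 (n l : ℕ) (r : ℝ) (D : Set (Euc l)) (f : ℝ → (ℝ → Euc n) → Euc l → Euc n) : Prop :=
  ∀ ε > 0, ∀ t, 0 ≤ t → ∃ δ > 0, ∀ τ x d, 0 ≤ τ → d ∈ D → ContinuousOn x (Icc (-r) 0) →
    |τ - t| + histNorm n r x < δ → ‖f τ x d‖ < ε

/-- A solution of the RFDE on `[t₀ - r, T)` (continuous, absolutely continuous on compact
subintervals of `[t₀,T)` and satisfying the equation a.e., expressed in integral form). -/
def IsSolIco (n l : ℕ) (r : ℝ) (f : ℝ → (ℝ → Euc n) → Euc l → Euc n) (d : ℝ → Euc l)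
    (t₀ T : ℝ) (x : ℝ → Euc n) : Prop :=
  ContinuousOn x (Ico (t₀ - r) T) ∧
  ∀ t ∈ Ico t₀ T,
    IntervalIntegrable (fun s => f s (fun θ => x (s + θ)) (d s)) volume t₀ t ∧
    x t = x t₀ + ∫ s in t₀..t, f s (fun θ => x (s + θ)) (d s)

/-- A solution of the RFDE on all of `[t₀ - r, ∞)`. -/
def IsSolGlobal (n l : ℕ) (r : ℝ) (f : ℝ → (ℝ → Euc n) → Euc l → Euc n) (d : ℝ → Euc l)
    (t₀ : ℝ) (x : ℝ → Euc n) : Prop :=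
  ContinuousOn x (Ici (t₀ - r)) ∧
  ∀ t, t₀ ≤ t →
    IntervalIntegrable (fun s => f s (fun θ => x (s + θ)) (d s)) volume t₀ t ∧
    x t = x t₀ + ∫ s in t₀..t, f s (fun θ => x (s + θ)) (d s)

/-- Non-uniform in time robust global asymptotic stability of `0` for the RFDE:
every maximal solution is defined on `[t₀,∞)` and satisfies the `KL` estimate (2.6). -/
def RGASnu (n l : ℕ) (r : ℝ) (D : Set (Euc l))
    (f : ℝ → (ℝ → Euc n) → Euc l → Euc n) : Prop :=
  ∃ σ : ℝ → ℝ → ℝ, ∃ β : ℝ → ℝ, IsKL σ ∧ IsKPlus β ∧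
    (∀ t₀ x₀ d, 0 ≤ t₀ → ContinuousOn x₀ (Icc (-r) 0) → MD l D d →
      ∃ x : ℝ → Euc n, IsSolGlobal n l r f d t₀ x ∧ ∀ θ ∈ Icc (-r) 0, x (t₀ + θ) = x₀ θ) ∧
    (∀ t₀ x₀ d x, 0 ≤ t₀ → ContinuousOn x₀ (Icc (-r) 0) → MD l D d →
      IsSolGlobal n l r f d t₀ x → (∀ θ ∈ Icc (-r) 0, x (t₀ + θ) = x₀ θ) →
      ∀ t, t₀ ≤ t →
        histNorm n r (fun θ => x (t + θ)) ≤ σ (β t₀ * histNorm n r x₀) (t - t₀))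

/-- Uniform robust global asymptotic stability of `0` for the RFDE. -/
def URGAS (n l : ℕ) (r : ℝ) (D : Set (Euc l))
    (f : ℝ → (ℝ → Euc n) → Euc l → Euc n) : Prop :=
  ∃ σ : ℝ → ℝ → ℝ, IsKL σ ∧
    (∀ t₀ x₀ d, 0 ≤ t₀ → ContinuousOn x₀ (Icc (-r) 0) → MD l D d →
      ∃ x : ℝ → Euc n, IsSolGlobal n l r f d t₀ x ∧ ∀ θ ∈ Icc (-r) 0, x (t₀ + θ) = x₀ θ) ∧
    (∀ t₀ x₀ d x, 0 ≤ t₀ → ContinuousOn x₀ (Icc (-r) 0) → MD l D d →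
      IsSolGlobal n l r f d t₀ x → (∀ θ ∈ Icc (-r) 0, x (t₀ + θ) = x₀ θ) →
      ∀ t, t₀ ≤ t →
        histNorm n r (fun θ => x (t + θ)) ≤ σ (histNorm n r x₀) (t - t₀))

/-- The translate `θ ↦ x (t + θ)`, whose restriction to `[-q,0]` is the history of `x` at `t`. -/
abbrev seg {n : ℕ} (x : ℝ → Euc n) (t : ℝ) : ℝ → Euc n := fun θ => x (t + θ)

section HistNorm

variable {n : ℕ} {q : ℝ}

lemma histNorm_le (hq : 0 ≤ q) {y : ℝ → Euc n} {c : ℝ} (h : ∀ θ ∈ Icc (-q) 0, ‖y θ‖ ≤ c) :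
    histNorm n q y ≤ c := by
  apply csSup_le
  · exact ⟨_, 0, ⟨by linarith, le_rfl⟩, rfl⟩
  · rintro _ ⟨θ, hθ, rfl⟩
    exact h θ hθ

lemma norm_le_histNorm {y : ℝ → Euc n} (hy : ContinuousOn y (Icc (-q) 0)) {θ : ℝ}
    (hθ : θ ∈ Icc (-q) 0) : ‖y θ‖ ≤ histNorm n q y :=
  le_csSup (isCompact_Icc.image_of_continuousOn hy.norm).bddAbove ⟨θ, hθ, rfl⟩

lemma histNorm_nonneg (y : ℝ → Euc n) : 0 ≤ histNorm n q y := by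
  apply Real.sSup_nonneg
  rintro _ ⟨θ, _, rfl⟩
  exact norm_nonneg _

lemma histNorm_congr {x y : ℝ → Euc n} (h : EqOn x y (Icc (-q) 0)) :
    histNorm n q x = histNorm n q y := by
  unfold histNorm
  congr 1
  exact image_congr fun θ hθ => by rw [h hθ]

lemma histNorm_sub_le (hq : 0 ≤ q) {x y : ℝ → Euc n} (hx : ContinuousOn x (Icc (-q) 0))
    (hy : ContinuousOn y (Icc (-q) 0)) :
    |histNorm n q x - histNorm n q y| ≤ histNorm n q (x - y) := by
  have key : ∀ u v : ℝ → Euc n, ContinuousOn u (Icc (-q) 0) → ContinuousOn v (Icc (-q) 0) →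
      histNorm n q u ≤ histNorm n q v + histNorm n q (u - v) := by
    intro u v hu hv
    refine histNorm_le hq fun θ hθ => ?_
    have h1 := norm_le_histNorm hv hθ
    have h2 := norm_le_histNorm (hu.sub hv) hθ
    have h3 : ‖u θ‖ ≤ ‖v θ‖ + ‖(u - v) θ‖ := by
      have := norm_add_le (v θ) ((u - v) θ)
      simpa using this
    exact h3.trans (add_le_add h1 h2)
  have hsymm : histNorm n q (y - x) = histNorm n q (x - y) := by
    unfold histNorm
    congr 1
    exact image_congr fun θ _ => norm_sub_rev _ _
  have h1 := key x y hx hy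
  have h2 := key y x hy hx
  rw [abs_le]
  constructor <;> linarith

lemma continuous_seg {x : ℝ → Euc n} (hx : Continuous x) (t : ℝ) : Continuous (seg x t) := by
  fun_prop

lemma tendsto_histNorm_seg_sub (hq : 0 ≤ q) {x : ℝ → Euc n} (hx : Continuous x) (t : ℝ) :
    Tendsto (fun s => histNorm n q (seg x s - seg x t)) (nhds t) (nhds 0) := by
  have h : Continuous fun s => histNorm n q (seg x s - seg x t) := by
    have := (isCompact_Icc (a := -q) (b := (0:ℝ))).continuous_sSup
      (f := fun s θ => ‖x (s + θ) - x (t + θ)‖)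
      (by fun_prop)
    exact this
  have h0 : histNorm n q (seg x t - seg x t) = 0 := by
    rw [sub_self]
    exact le_antisymm (histNorm_le hq fun θ _ => by simp) (histNorm_nonneg _)
  simpa only [h0] using h.tendsto t

lemma exists_bound_of_continuous {x : ℝ → Euc n} (hx : Continuous x) (a b : ℝ) :
    ∃ R, 0 ≤ R ∧ ∀ s ∈ Icc a b, ‖x s‖ ≤ R := by
  obtain ⟨R, hR⟩ := (isCompact_Icc (a := a) (b := b)).exists_bound_of_continuousOn hx.continuousOn
  exact ⟨max R 0, le_max_right _ _, fun s hs => (hR s hs).trans (le_max_left _ _)⟩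

end HistNorm

/-- A set of times without finite accumulation point. -/
def LocFin (A : Set ℝ) : Prop := ∀ C : ℝ, (A ∩ Icc 0 C).Finite

/-- Joint continuity of `g` at all times outside of `A`. -/
def ContOff (n l : ℕ) (r : ℝ) (D : Set (Euc l)) (A : Set ℝ)
    (g : ℝ → (ℝ → Euc n) → Euc l → Euc n) : Prop :=
  ∀ t x d, 0 ≤ t → t ∉ A → ContinuousOn x (Icc (-r) 0) → d ∈ D →
      ∀ ε > 0, ∃ δ > 0, ∀ t' x' d', 0 ≤ t' → ContinuousOn x' (Icc (-r) 0) → d' ∈ D →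
        |t' - t| < δ → histNorm n r (x' - x) < δ → ‖d' - d‖ < δ →
          ‖g t' x' d' - g t x d‖ < ε

/-- `g` depends on its second argument through its restriction to `[-r,0]` only. -/
def LocalField (n l : ℕ) (r : ℝ) (D : Set (Euc l))
    (g : ℝ → (ℝ → Euc n) → Euc l → Euc n) : Prop :=
  ∀ t x y d, 0 ≤ t → ContinuousOn x (Icc (-r) 0) → d ∈ D → EqOn x y (Icc (-r) 0) →
    g t x d = g t y d

section Field

variable {n l : ℕ} {r : ℝ} {D : Set (Euc l)} {A : Set ℝ}
  {g : ℝ → (ℝ → Euc n) → Euc l → Euc n} {d : ℝ → Euc l}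

/-- A time `t ≥ 0` has a right neighbourhood free of exceptional times. -/
lemma LocFin.exists_gap (hA : LocFin A) {t : ℝ} (ht : 0 ≤ t) :
    ∃ δ > 0, ∀ s, t < s → s < t + δ → s ∉ A := by
  have hfin : ((A ∩ Icc 0 (t + 1)) \ {t}).Finite := (hA (t + 1)).subset sdiff_subset
  have hmem : ((A ∩ Icc 0 (t + 1)) \ {t})ᶜ ∈ nhds t :=
    hfin.isClosed.isOpen_compl.mem_nhds (by simp)
  obtain ⟨ε, hε, hball⟩ := Metric.mem_nhds_iff.1 hmem
  refine ⟨min ε 1, lt_min hε one_pos, fun s hs hs' hsA => ?_⟩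
  have h1 : s < t + ε := hs'.trans_le (by gcongr; exact min_le_left _ _)
  have h2 : s < t + 1 := hs'.trans_le (by gcongr; exact min_le_right _ _)
  have : s ∈ Metric.ball t ε := by
    rw [Metric.mem_ball, Real.dist_eq, abs_lt]
    constructor <;> linarith
  exact hball this ⟨⟨hsA, by linarith, h2.le⟩, hs.ne'⟩

lemma H3.exists_contOff {f : ℝ → (ℝ → Euc n) → Euc l → Euc n} (hr : 0 ≤ r)
    (h : H3 n l r D f) :
    ∃ A, LocFin A ∧ ContOff n l r D A f ∧ LocalField n l r D f := by
  obtain ⟨A, hA, hc, hrc⟩ := h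
  refine ⟨A, hA, hc, ?_⟩
  intro t x y d ht hx hd hxy
  have hy : ContinuousOn y (Icc (-r) 0) := hx.congr hxy.symm
  have hzero : histNorm n r (y - x) = 0 :=
    le_antisymm (histNorm_le hr fun θ hθ => by simp [hxy hθ]) (histNorm_nonneg _)
  have hoff : ∀ s, 0 ≤ s → s ∉ A → f s y d = f s x d := by
    intro s hs hsA
    by_contra hne
    have hpos : 0 < ‖f s y d - f s x d‖ := norm_pos_iff.2 (sub_ne_zero.2 hne)
    obtain ⟨δ, hδ, hh⟩ := hc s x d hs hsA hx hd _ hpos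
    exact lt_irrefl _ (hh s y d hs hy hd (by simpa) (by rw [hzero]; exact hδ) (by simpa))
  obtain ⟨δ₀, hδ₀, hgap⟩ := LocFin.exists_gap hA ht
  by_contra hne
  have hpos : 0 < ‖f t x d - f t y d‖ / 2 := half_pos (norm_pos_iff.2 (sub_ne_zero.2 hne))
  obtain ⟨δ₁, hδ₁, hx1⟩ := hrc t x d ht hx hd _ hpos
  obtain ⟨δ₂, hδ₂, hy1⟩ := hrc t y d ht hy hd _ hpos
  obtain ⟨h, hh0, hhlt⟩ := exists_between (lt_min hδ₀ (lt_min hδ₁ hδ₂))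
  have e0 : h < δ₀ := hhlt.trans_le (min_le_left _ _)
  have e1 : h < δ₁ := hhlt.trans_le ((min_le_right _ _).trans (min_le_left _ _))
  have e2 : h < δ₂ := hhlt.trans_le ((min_le_right _ _).trans (min_le_right _ _))
  have k1 := hx1 (t + h) (by linarith) (by linarith)
  have k2 := hy1 (t + h) (by linarith) (by linarith)
  rw [hoff (t + h) (by linarith) (hgap _ (by linarith) (by linarith))] at k2
  have : ‖f t x d - f t y d‖ ≤ ‖f (t + h) x d - f t y d‖ + ‖f (t + h) x d - f t x d‖ := by
    have := norm_sub_le (f (t + h) x d - f t y d) (f (t + h) x d - f t x d)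
    simpa using this
  linarith

lemma ContOff.rhs_continuousWithinAt (hr : 0 ≤ r) (hg : ContOff n l r D A g) (hd : MD l D d)
    {x : ℝ → Euc n} (hx : Continuous x) {t : ℝ} (ht : 0 ≤ t) (htA : t ∉ A) {S : Set ℝ}
    (hS : S ⊆ Ici 0) (hdt : ContinuousWithinAt d S t) :
    ContinuousWithinAt (fun s => g s (seg x s) (d s)) S t := by
  rw [ContinuousWithinAt, Metric.tendsto_nhds]
  intro ε hε
  obtain ⟨δ, hδ, h⟩ := hg t (seg x t) (d t) ht htA (continuous_seg hx t).continuousOn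
    (hd.1 t ht) ε hε
  have e1 : ∀ᶠ s in nhdsWithin t S, |s - t| < δ :=
    nhdsWithin_le_nhds (Metric.ball_mem_nhds t hδ)
  have e2 : ∀ᶠ s in nhdsWithin t S, histNorm n r (seg x s - seg x t) < δ :=
    nhdsWithin_le_nhds ((tendsto_histNorm_seg_sub hr hx t).eventually (gt_mem_nhds hδ))
  have e3 : ∀ᶠ s in nhdsWithin t S, ‖d s - d t‖ < δ := by
    simpa [dist_eq_norm] using Metric.tendsto_nhds.1 hdt δ hδ
  filter_upwards [e1, e2, e3, self_mem_nhdsWithin] with s h1 h2 h3 hs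
  rw [dist_eq_norm]
  exact h s _ _ (hS hs) (continuous_seg hx s).continuousOn (hd.1 s (hS hs)) h1 h2 h3

lemma MD.continuousWithinAt_right (hd : MD l D d) {t : ℝ} (ht : 0 ≤ t) :
    ContinuousWithinAt d (Ici t) t := by
  rw [Metric.continuousWithinAt_iff]
  intro ε hε
  obtain ⟨δ, hδ, h⟩ := hd.2.1 t ht ε hε
  refine ⟨δ, hδ, fun s hs hst => ?_⟩
  rw [Real.dist_eq] at hst
  rw [dist_eq_norm]
  exact h s hs ((le_abs_self _).trans_lt hst)

lemma MD.exists_continuousWithinAt (hd : MD l D d) :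
    ∃ B, LocFin B ∧ ∀ t, 0 ≤ t → t ∉ B → ContinuousWithinAt d (Ici 0) t := by
  obtain ⟨B, hB, h⟩ := hd.2.2
  refine ⟨B, hB, fun t ht htB => ?_⟩
  rw [Metric.continuousWithinAt_iff]
  intro ε hε
  obtain ⟨δ, hδ, h'⟩ := h t ht htB ε hε
  refine ⟨δ, hδ, fun s hs hst => ?_⟩
  rw [dist_eq_norm]
  exact h' s hs (by rwa [Real.dist_eq] at hst)

lemma LocFin.union {B : Set ℝ} (hA : LocFin A) (hB : LocFin B) : LocFin (A ∪ B) := fun C => by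
  rw [union_inter_distrib_right]
  exact (hA C).union (hB C)

/-- Outside of a locally finite set of times the right-hand side along `x` is continuous. -/
lemma ContOff.exists_rhs_continuousWithinAt (hr : 0 ≤ r) (hA : LocFin A)
    (hg : ContOff n l r D A g) (hd : MD l D d) :
    ∃ B, LocFin B ∧ ∀ x : ℝ → Euc n, Continuous x → ∀ t, 0 ≤ t → t ∉ B →
      ContinuousWithinAt (fun s => g s (seg x s) (d s)) (Ici 0) t := by
  obtain ⟨B, hB, hdB⟩ := hd.exists_continuousWithinAt
  refine ⟨A ∪ B, hA.union hB, fun x hx t ht htB => ?_⟩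
  rw [mem_union, not_or] at htB
  exact hg.rhs_continuousWithinAt hr hd hx ht htB.1 Subset.rfl (hdB t ht htB.2)

lemma ContOff.rhs_aestronglyMeasurable (hr : 0 ≤ r) (hA : LocFin A)
    (hg : ContOff n l r D A g) (hd : MD l D d) {x : ℝ → Euc n} (hx : Continuous x)
    {a b : ℝ} (ha : 0 ≤ a) :
    AEStronglyMeasurable (fun s => g s (seg x s) (d s)) (volume.restrict (Icc a b)) := by
  obtain ⟨B, hB, hcont⟩ := hg.exists_rhs_continuousWithinAt hr hA hd
  have hBf := hB b
  have hset : (Icc a b \ (B ∩ Icc 0 b) : Set ℝ) =ᵐ[volume] Icc a b :=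
    sdiff_null_ae_eq_self (hBf.measure_zero _)
  rw [← Measure.restrict_congr_set hset]
  refine ContinuousOn.aestronglyMeasurable ?_ (measurableSet_Icc.diff hBf.measurableSet)
  intro t ht
  refine (hcont x hx t (ha.trans ht.1.1) fun htB => ht.2 ⟨htB, ha.trans ht.1.1, ht.1.2⟩).mono ?_
  exact fun s hs => ha.trans hs.1.1

lemma ContOff.rhs_intervalIntegrable (hr : 0 ≤ r) (hA : LocFin A)
    (hg : ContOff n l r D A g) (hd : MD l D d) {x : ℝ → Euc n} (hx : Continuous x)
    {a b C : ℝ} (ha : 0 ≤ a) (hab : a ≤ b)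
    (hC : ∀ s ∈ Icc a b, ‖g s (seg x s) (d s)‖ ≤ C) :
    IntervalIntegrable (fun s => g s (seg x s) (d s)) volume a b := by
  rw [intervalIntegrable_iff_integrableOn_Icc_of_le hab]
  refine Integrable.of_bound (hg.rhs_aestronglyMeasurable hr hA hd hx ha) C ?_
  exact (ae_restrict_iff' measurableSet_Icc).2 (Eventually.of_forall hC)

end Field

lemma norm_primitive_sub_le {n : ℕ} {F : ℝ → Euc n} {a b C u v : ℝ}
    (hF : IntervalIntegrable F volume a b) (hC : ∀ s ∈ Icc a b, ‖F s‖ ≤ C)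
    (hu : u ∈ Icc a b) (hv : v ∈ Icc a b) :
    ‖(∫ s in a..u, F s) - ∫ s in a..v, F s‖ ≤ C * |u - v| := by
  have hab : a ≤ b := hu.1.trans hu.2
  have hi : ∀ w ∈ Icc a b, IntervalIntegrable F volume a w := fun w hw =>
    hF.mono_set (by rw [uIcc_of_le hab, uIcc_of_le hw.1]; exact Icc_subset_Icc le_rfl hw.2)
  rw [intervalIntegral.integral_interval_sub_left (hi u hu) (hi v hv)]
  refine intervalIntegral.norm_integral_le_of_norm_le_const fun s hs => hC s ?_
  have : s ∈ uIcc v u := uIoc_subset_uIcc hs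
  exact (uIcc_subset_Icc hv hu) this

section Existence

variable {n l : ℕ} {r : ℝ} {D : Set (Euc l)} {A : Set ℝ}
  {g : ℝ → (ℝ → Euc n) → Euc l → Euc n} {d : ℝ → Euc l}

/-- Tonelli's approximations: solutions of the equation with delayed integral. -/
lemma exists_tonelli_approx (hr : 0 ≤ r) (hA : LocFin A) (hg : ContOff n l r D A g)
    (hloc : LocalField n l r D g) (hd : MD l D d) {φ : ℝ → Euc n} (hφ : Continuous φ)
    {t₀ T C δ : ℝ} (ht₀ : 0 ≤ t₀) (hT : t₀ ≤ T) (hδ : 0 < δ)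
    (hC : ∀ t x d, 0 ≤ t → t ≤ T → ContinuousOn x (Icc (-r) 0) → d ∈ D → ‖g t x d‖ ≤ C) :
    ∃ x : ℝ → Euc n, Continuous x ∧ ∀ t ≤ T,
      x t = φ (min t t₀) + ∫ s in t₀..(max t₀ (t - δ)), g s (seg x s) (d s) := by
  have hb : ∀ x : ℝ → Euc n, Continuous x → ∀ s ∈ Icc t₀ T, ‖g s (seg x s) (d s)‖ ≤ C :=
    fun x hx s hs => hC s _ _ (ht₀.trans hs.1) hs.2 (continuous_seg hx s).continuousOn
      (hd.1 s (ht₀.trans hs.1))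
  let c : ℝ → ℝ := fun t => max t₀ (min (t - δ) T)
  have hc : Continuous c := by fun_prop
  have hcm : ∀ t, c t ∈ Icc t₀ T := fun t => ⟨le_max_left _ _, max_le hT (min_le_right _ _)⟩
  let Φ : (ℝ → Euc n) → ℝ → Euc n := fun x t =>
    φ (min t t₀) + ∫ s in t₀..(c t), g s (seg x s) (d s)
  have hΦ : ∀ x, Continuous x → Continuous (Φ x) := by
    intro x hx
    have hint := hg.rhs_intervalIntegrable hr hA hd hx ht₀ hT (hb x hx)
    refine Continuous.add (by fun_prop) ?_
    have hprim := intervalIntegral.continuousOn_primitive_interval' hint left_mem_uIcc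
    rw [uIcc_of_le hT] at hprim
    exact hprim.comp_continuous hc hcm
  let X : ℕ → ℝ → Euc n := fun m => Φ^[m] fun t => φ (min t t₀)
  have hXs : ∀ m, X (m + 1) = Φ (X m) := fun m => Function.iterate_succ_apply' _ _ _
  have hX : ∀ m, Continuous (X m) := by
    intro m
    induction m with
    | zero => show Continuous fun t => φ (min t t₀); fun_prop
    | succ m ih => rw [hXs]; exact hΦ _ ih
  have hstab : ∀ m : ℕ, ∀ t ≤ t₀ + m * δ, X (m + 1) t = X m t := by
    intro m
    induction m with
    | zero =>
      intro t ht
      have ht : t ≤ t₀ := by simpa using ht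
      rw [hXs]
      have hct : c t = t₀ := max_eq_left ((min_le_left _ _).trans (by linarith))
      simp only [Φ, hct, intervalIntegral.integral_same, add_zero]
      rfl
    | succ m ih =>
      intro t ht
      rw [congrFun (hXs (m + 1)) t, congrFun (hXs m) t]
      refine congrArg (φ (min t t₀) + ·) ?_
      refine intervalIntegral.integral_congr fun s hs => ?_
      rw [uIcc_of_le (hcm t).1] at hs
      have hst : s ≤ t₀ + m * δ := by
        refine hs.2.trans (max_le (by nlinarith [(Nat.cast_nonneg m : (0:ℝ) ≤ m)]) ?_)
        refine (min_le_left _ _).trans ?_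
        push_cast at ht
        linarith
      have hs0 : 0 ≤ s := ht₀.trans hs.1
      refine hloc s _ _ _ hs0 (continuous_seg (hX (m + 1)) s).continuousOn (hd.1 s hs0) ?_
      intro θ hθ
      exact ih _ (by linarith [hθ.2])
  obtain ⟨m, hm⟩ := exists_nat_ge ((T - t₀) / δ)
  rw [div_le_iff₀ hδ] at hm
  refine ⟨X m, hX m, fun t ht => ?_⟩
  rw [← hstab m t (by linarith), hXs]
  simp only [Φ, c]
  rw [min_eq_left (by linarith : t - δ ≤ T)]

/-- Peano's theorem for bounded fields that are continuous off a locally finite set of times. -/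
theorem exists_solution_of_bounded (hr : 0 ≤ r) (hA : LocFin A) (hg : ContOff n l r D A g)
    (hloc : LocalField n l r D g) (hd : MD l D d) {φ : ℝ → Euc n} (hφ : Continuous φ)
    {t₀ T C : ℝ} (ht₀ : 0 ≤ t₀) (hT : t₀ ≤ T)
    (hC : ∀ t x d, 0 ≤ t → t ≤ T → ContinuousOn x (Icc (-r) 0) → d ∈ D → ‖g t x d‖ ≤ C) :
    ∃ x : ℝ → Euc n, Continuous x ∧ (∀ t ≤ t₀, x t = φ t) ∧ ∀ t ∈ Icc t₀ T,
      x t = φ t₀ + ∫ s in t₀..t, g s (seg x s) (d s) := by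
  have hb : ∀ x : ℝ → Euc n, Continuous x → ∀ s ∈ Icc t₀ T, ‖g s (seg x s) (d s)‖ ≤ C :=
    fun x hx s hs => hC s _ _ (ht₀.trans hs.1) hs.2 (continuous_seg hx s).continuousOn
      (hd.1 s (ht₀.trans hs.1))
  have hC0 : 0 ≤ C := (norm_nonneg _).trans (hb φ hφ t₀ ⟨le_rfl, hT⟩)
  let δ : ℕ → ℝ := fun k => 1 / ((k : ℝ) + 1)
  have hδ : ∀ k, 0 < δ k := fun k => Nat.one_div_pos_of_nat
  have hδ0 : Tendsto δ atTop (nhds 0) := tendsto_one_div_add_atTop_nhds_zero_nat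
  choose X hXc hX using fun k => exists_tonelli_approx hr hA hg hloc hd hφ ht₀ hT (hδ k) hC
  have hint : ∀ x : ℝ → Euc n, Continuous x →
      IntervalIntegrable (fun s => g s (seg x s) (d s)) volume t₀ T := fun x hx =>
    hg.rhs_intervalIntegrable hr hA hd hx ht₀ hT (hb x hx)
  have hmem : ∀ k, ∀ t ∈ Icc t₀ T, max t₀ (t - δ k) ∈ Icc t₀ T := fun k t ht =>
    ⟨le_max_left _ _, max_le hT (by linarith [ht.2, hδ k])⟩
  have hXdiff : ∀ k, ∀ t ∈ Icc t₀ T, X k t - φ t₀ =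
      ∫ s in t₀..(max t₀ (t - δ k)), g s (seg (X k) s) (d s) := by
    intro k t ht
    rw [hX k t ht.2, min_eq_right ht.1, add_sub_cancel_left]
  have hlip : ∀ k, ∀ s ∈ Icc t₀ T, ∀ t ∈ Icc t₀ T, ‖(X k s - φ t₀) - (X k t - φ t₀)‖ ≤
      C * |s - t| := by
    intro k s hs t ht
    rw [hXdiff k s hs, hXdiff k t ht]
    refine (norm_primitive_sub_le (hint _ (hXc k)) (hb _ (hXc k)) (hmem k s hs)
      (hmem k t ht)).trans ?_
    refine mul_le_mul_of_nonneg_left ?_ hC0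
    simpa using abs_max_sub_max_le_max t₀ (s - δ k) t₀ (t - δ k)
  have hX0 : ∀ k, ∀ t ≤ t₀, X k t = φ t := by
    intro k t ht
    rw [hX k t (ht.trans hT), min_eq_left ht, max_eq_left (by linarith [hδ k])]
    simp
  let ψ : ℕ → BoundedContinuousFunction (Icc t₀ T) (Euc n) := fun k =>
    BoundedContinuousFunction.mkOfCompact
      ⟨fun t => X k t - φ t₀, by have := hXc k; fun_prop⟩
  have hψ : ∀ k (t : Icc t₀ T), ψ k t = X k t - φ t₀ := fun k t => rfl
  have hcomp : IsCompact (closure (range ψ)) := by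
    refine BoundedContinuousFunction.arzela_ascoli (Metric.closedBall 0 (C * |T - t₀|))
      (isCompact_closedBall _ _) _ ?_ ?_
    · rintro _ t ⟨k, rfl⟩
      rw [mem_closedBall_zero_iff, hψ]
      have h1 := hlip k t t.2 t₀ ⟨le_rfl, hT⟩
      rw [hX0 k t₀ le_rfl, sub_self, sub_zero] at h1
      refine h1.trans ?_
      have : |(t : ℝ) - t₀| ≤ |T - t₀| := by
        rw [abs_of_nonneg (sub_nonneg.2 t.2.1), abs_of_nonneg (sub_nonneg.2 hT)]
        linarith [t.2.2]
      gcongr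
    · refine (LipschitzWith.uniformEquicontinuous _ C.toNNReal ?_).equicontinuous
      rintro ⟨_, k, rfl⟩
      refine LipschitzWith.of_dist_le_mul fun s t => ?_
      rw [dist_eq_norm, Real.coe_toNNReal _ hC0]
      exact hlip k s s.2 t t.2
  obtain ⟨Ψ, -, κ, hκ, hlim⟩ :=
    hcomp.tendsto_subseq fun k => subset_closure (mem_range_self (f := ψ) k)
  let x : ℝ → Euc n := fun t => φ (min t t₀) + Ψ (projIcc t₀ T hT t)
  have hx : Continuous x := by
    refine Continuous.add (by fun_prop) (Ψ.continuous.comp continuous_projIcc)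
  have hΨt : ∀ t, Tendsto (fun k => ψ (κ k) t) atTop (nhds (Ψ t)) := fun t =>
    (BoundedContinuousFunction.tendsto_iff_tendstoUniformly.1 hlim).tendsto_at t
  have hΨ0 : Ψ (⟨t₀, le_rfl, hT⟩ : Icc t₀ T) = 0 := by
    refine tendsto_nhds_unique (hΨt _) ?_
    simp only [hψ, hX0 _ t₀ le_rfl, sub_self]
    exact tendsto_const_nhds
  have hx0 : ∀ t ≤ t₀, x t = φ t := by
    intro t ht
    simp only [x, min_eq_left ht, projIcc_of_le_left hT ht]
    rw [hΨ0, add_zero]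
  have hclose : ∀ k, ∀ t ≤ T, ‖X (κ k) t - x t‖ ≤ dist (ψ (κ k)) Ψ := by
    intro k t ht
    rcases le_total t t₀ with h | h
    · rw [hX0 _ t h, hx0 t h, sub_self, norm_zero]
      exact dist_nonneg
    · have h1 := BoundedContinuousFunction.dist_coe_le_dist (f := ψ (κ k)) (g := Ψ)
        (⟨t, h, ht⟩ : Icc t₀ T)
      rw [dist_eq_norm, hψ] at h1
      simp only [x, min_eq_right h, projIcc_of_mem hT ⟨h, ht⟩]
      rwa [← sub_sub]
  have hdist : Tendsto (fun k => dist (ψ (κ k)) Ψ) atTop (nhds 0) :=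
    tendsto_iff_dist_tendsto_zero.1 hlim
  refine ⟨x, hx, hx0, fun t ht => ?_⟩
  have hL : Tendsto (fun k => X (κ k) t - φ t₀) atTop (nhds (x t - φ t₀)) := by
    refine Tendsto.sub_const ?_ _
    rw [tendsto_iff_norm_sub_tendsto_zero]
    exact squeeze_zero (fun _ => norm_nonneg _) (fun k => hclose k t ht.2) hdist
  have hI : Tendsto (fun k => ∫ s in t₀..t, g s (seg (X (κ k)) s) (d s)) atTop
      (nhds (∫ s in t₀..t, g s (seg x s) (d s))) := by
    refine intervalIntegral.tendsto_integral_filter_of_dominated_convergence (fun _ => C) ?_ ?_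
      (by simp) ?_
    · refine Eventually.of_forall fun k => ?_
      rw [uIoc_of_le ht.1]
      exact (hg.rhs_aestronglyMeasurable hr hA hd (hXc _) ht₀).mono_measure
        (Measure.restrict_mono Ioc_subset_Icc_self le_rfl)
    · refine Eventually.of_forall fun k => Eventually.of_forall fun s hs => ?_
      rw [uIoc_of_le ht.1] at hs
      exact hb _ (hXc _) s ⟨hs.1.le, hs.2.trans ht.2⟩
    · have hnull : volume (A ∩ Icc 0 T) = 0 := (hA T).measure_zero _
      filter_upwards [measure_eq_zero_iff_ae_notMem.1 hnull] with s hsA hs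
      rw [uIoc_of_le ht.1] at hs
      have hs0 : 0 ≤ s := ht₀.trans hs.1.le
      have hsT : s ≤ T := hs.2.trans ht.2
      rw [Metric.tendsto_nhds]
      intro ε hε
      obtain ⟨η, hη, h⟩ := hg s (seg x s) (d s) hs0 (fun h => hsA ⟨h, hs0, hsT⟩)
        (continuous_seg hx s).continuousOn (hd.1 s hs0) ε hε
      filter_upwards [hdist.eventually (gt_mem_nhds hη)] with k hk
      rw [dist_eq_norm]
      refine h s _ _ hs0 (continuous_seg (hXc _) s).continuousOn (hd.1 s hs0) (by simpa)
        (lt_of_le_of_lt (histNorm_le hr fun θ hθ => ?_) hk) (by simpa)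
      exact hclose k _ (by linarith [hθ.2])
  have hE : Tendsto (fun k => (X (κ k) t - φ t₀) -
      ∫ s in t₀..t, g s (seg (X (κ k)) s) (d s)) atTop (nhds 0) := by
    have hz : Tendsto (fun k => C * δ (κ k)) atTop (nhds 0) := by
      simpa using (hδ0.comp hκ.tendsto_atTop).const_mul C
    refine squeeze_zero_norm (fun k => ?_) hz
    rw [hXdiff _ t ht]
    refine (norm_primitive_sub_le (hint _ (hXc _)) (hb _ (hXc _)) (hmem _ t ht) ht).trans ?_
    gcongr
    have h1 := le_max_right t₀ (t - δ (κ k))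
    have h2 : max t₀ (t - δ (κ k)) ≤ t := max_le ht.1 (by linarith [hδ (κ k)])
    rw [abs_le]
    constructor <;> linarith [hδ (κ k)]
  have := tendsto_nhds_unique (hL.sub hI) hE
  rw [sub_eq_zero, sub_eq_iff_eq_add'] at this
  exact this

end Existence

/-- Comparison principle for a function `w` that is lower semicontinuous from the left: a bound
`w ≤ B` that propagates locally to the right holds on the whole interval. -/
lemma le_on_Icc_of_local {w B : ℝ → ℝ} {a b : ℝ}
    (hlsc : ∀ t ∈ Ioc a b, ∀ ε > 0, ∃ δ > 0, ∀ s ∈ Icc a b, |s - t| < δ → w t - ε < w s)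
    (hB : ContinuousOn B (Icc a b)) (h0 : w a ≤ B a)
    (hloc : ∀ t ∈ Ico a b, (∀ s ∈ Icc a t, w s ≤ B s) →
      ∃ δ > 0, ∀ s, t < s → s < t + δ → s ≤ b → w s ≤ B s) :
    ∀ t ∈ Icc a b, w t ≤ B t := by
  intro t₁ ht₁
  have hab : a ≤ b := ht₁.1.trans ht₁.2
  let S : Set ℝ := {t | t ∈ Icc a b ∧ ∀ s ∈ Icc a t, w s ≤ B s}
  have haS : a ∈ S := by
    refine ⟨⟨le_rfl, hab⟩, fun s hs => ?_⟩
    rw [le_antisymm hs.2 hs.1]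
    exact h0
  have hbdd : BddAbove S := ⟨b, fun t ht => ht.1.2⟩
  let c := sSup S
  have hac : a ≤ c := le_csSup hbdd haS
  have hcb : c ≤ b := csSup_le ⟨a, haS⟩ fun t ht => ht.1.2
  have hlt : ∀ s, a ≤ s → s < c → w s ≤ B s := by
    intro s hs hsc
    obtain ⟨t, ht, hst⟩ := exists_lt_of_lt_csSup ⟨a, haS⟩ hsc
    exact ht.2 s ⟨hs, hst.le⟩
  have hc : w c ≤ B c := by
    rcases hac.eq_or_lt with h | h
    · rw [← h]; exact h0
    · refine le_of_forall_pos_le_add fun ε hε => ?_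
      obtain ⟨δ, hδ, hw⟩ := hlsc c ⟨h, hcb⟩ (ε / 2) (half_pos hε)
      obtain ⟨η, hη, hBη⟩ := Metric.continuousWithinAt_iff.1 (hB c ⟨hac, hcb⟩) (ε / 2) (half_pos hε)
      obtain ⟨s, hs1, hs2⟩ : ∃ s, max a (max (c - δ) (c - η)) < s ∧ s < c :=
        exists_between (max_lt h (max_lt (by linarith) (by linarith)))
      have k1 : a < s := (le_max_left _ _).trans_lt hs1
      have k2 : c - δ < s := ((le_max_left _ _).trans (le_max_right _ _)).trans_lt hs1
      have k3 : c - η < s := ((le_max_right _ _).trans (le_max_right _ _)).trans_lt hs1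
      have hsab : s ∈ Icc a b := ⟨k1.le, hs2.le.trans hcb⟩
      have e1 := hw s hsab (by rw [abs_lt]; constructor <;> linarith)
      have e2 := hBη hsab (by rw [Real.dist_eq, abs_lt]; constructor <;> linarith)
      rw [Real.dist_eq, abs_lt] at e2
      have e3 := hlt s k1.le hs2
      linarith [e2.2]
  have hcS : ∀ s ∈ Icc a c, w s ≤ B s := by
    intro s hs
    rcases hs.2.eq_or_lt with h | h
    · rw [h]; exact hc
    · exact hlt s hs.1 h
  have hcb' : c = b := by
    by_contra hne
    have hlt' : c < b := lt_of_le_of_ne hcb hne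
    obtain ⟨δ, hδ, h⟩ := hloc c ⟨hac, hlt'⟩ hcS
    obtain ⟨u, hu1, hu2⟩ := exists_between (lt_min (by linarith : c < c + δ) hlt')
    have hu3 : u < c + δ := hu2.trans_le (min_le_left _ _)
    have hu4 : u < b := hu2.trans_le (min_le_right _ _)
    have : u ∈ S := by
      refine ⟨⟨hac.trans hu1.le, hu4.le⟩, fun s hs => ?_⟩
      rcases le_or_gt s c with hsc | hsc
      · exact hcS s ⟨hs.1, hsc⟩
      · exact h s hsc (hs.2.trans_lt hu3) (hs.2.trans hu4.le)
    exact absurd (le_csSup hbdd this) (not_le.2 hu1)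
  exact hcS t₁ (by rw [hcb']; exact ht₁)

/-- `x` is a solution on `[a,b]`, and a continuous function on the whole real line. -/
def SolOn {n l : ℕ} (f : ℝ → (ℝ → Euc n) → Euc l → Euc n) (d : ℝ → Euc l) (x : ℝ → Euc n)
    (a b : ℝ) : Prop :=
  Continuous x ∧ ∀ s t, a ≤ s → s ≤ t → t ≤ b →
    x t = x s + ∫ u in s..t, f u (seg x u) (d u)

section Solutions

variable {n l : ℕ} {r : ℝ} {D : Set (Euc l)} {A : Set ℝ}
  {f : ℝ → (ℝ → Euc n) → Euc l → Euc n} {d : ℝ → Euc l}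

lemma SolOn.mono {x : ℝ → Euc n} {a b a' b' : ℝ} (h : SolOn f d x a b) (ha : a ≤ a')
    (hb : b' ≤ b) : SolOn f d x a' b' :=
  ⟨h.1, fun s t hs hst ht => h.2 s t (ha.trans hs) hst (ht.trans hb)⟩

lemma H2.exists_rhs_bound (hr : 0 ≤ r) (h2 : H2 n l r D f) (hd : MD l D d) {x : ℝ → Euc n}
    (hx : Continuous x) {a b : ℝ} (ha : 0 ≤ a) :
    ∃ C, ∀ s ∈ Icc a b, ‖f s (seg x s) (d s)‖ ≤ C := by
  obtain ⟨R, -, hR⟩ := exists_bound_of_continuous hx (a - r) b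
  obtain ⟨C, hC⟩ := h2 b R
  refine ⟨C, fun s hs => hC s _ _ (ha.trans hs.1) hs.2 (continuous_seg hx s).continuousOn ?_
    (hd.1 s (ha.trans hs.1))⟩
  exact histNorm_le hr fun θ hθ => hR _ ⟨by linarith [hs.1, hθ.1], by linarith [hs.2, hθ.2]⟩

lemma rhs_intervalIntegrable (hr : 0 ≤ r) (hA : LocFin A) (hf : ContOff n l r D A f)
    (h2 : H2 n l r D f) (hd : MD l D d) {x : ℝ → Euc n} (hx : Continuous x) {a b : ℝ}
    (ha : 0 ≤ a) (hab : a ≤ b) :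
    IntervalIntegrable (fun s => f s (seg x s) (d s)) volume a b := by
  obtain ⟨C, hC⟩ := h2.exists_rhs_bound hr hd hx (b := b) ha
  exact hf.rhs_intervalIntegrable hr hA hd hx ha hab hC

lemma SolOn.of_initial (hr : 0 ≤ r) (hA : LocFin A) (hf : ContOff n l r D A f)
    (h2 : H2 n l r D f) (hd : MD l D d) {x : ℝ → Euc n} (hx : Continuous x) {a b : ℝ}
    (ha : 0 ≤ a)
    (h : ∀ t ∈ Icc a b, x t = x a + ∫ s in a..t, f s (seg x s) (d s)) : SolOn f d x a b := by
  refine ⟨hx, fun s t hs hst ht => ?_⟩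
  rw [h s ⟨hs, hst.trans ht⟩, h t ⟨hs.trans hst, ht⟩, add_assoc,
    intervalIntegral.integral_add_adjacent_intervals]
  · exact rhs_intervalIntegrable hr hA hf h2 hd hx ha hs
  · exact rhs_intervalIntegrable hr hA hf h2 hd hx (ha.trans hs) hst

lemma SolOn.right_slope (hr : 0 ≤ r) (hA : LocFin A) (hf : ContOff n l r D A f)
    (h2 : H2 n l r D f) (hd : MD l D d) {x : ℝ → Euc n} {a b t : ℝ} (hx : SolOn f d x a b)
    (ha : 0 ≤ a) (hat : a ≤ t) (htb : t < b) (htA : t ∉ A) {ε : ℝ} (hε : 0 < ε) :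
    ∃ δ > 0, ∀ h, 0 ≤ h → h < δ →
      ‖x (t + h) - x t - h • f t (seg x t) (d t)‖ ≤ ε * h := by
  have ht0 : 0 ≤ t := ha.trans hat
  have hc := hf.rhs_continuousWithinAt hr hd hx.1 ht0 htA (S := Ici t)
    (fun s hs => ht0.trans hs) (hd.continuousWithinAt_right ht0)
  obtain ⟨δ, hδ, h⟩ := Metric.continuousWithinAt_iff.1 hc ε hε
  refine ⟨min δ (b - t), lt_min hδ (by linarith), fun u hu0 hu => ?_⟩
  have hu1 : u < δ := hu.trans_le (min_le_left _ _)
  have hu2 : u < b - t := hu.trans_le (min_le_right _ _)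
  have hi := rhs_intervalIntegrable hr hA hf h2 hd hx.1 ht0 (by linarith : t ≤ t + u)
  have e : x (t + u) - x t - u • f t (seg x t) (d t) =
      ∫ s in t..(t + u), (f s (seg x s) (d s) - f t (seg x t) (d t)) := by
    rw [intervalIntegral.integral_sub hi (by simp), hx.2 t (t + u) hat (by linarith) (by linarith)]
    simp
  rw [e]
  have := intervalIntegral.norm_integral_le_of_norm_le_const
    (f := fun s => f s (seg x s) (d s) - f t (seg x t) (d t)) (a := t) (b := t + u) (C := ε) ?_
  · simpa [abs_of_nonneg hu0] using this
  · intro s hs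
    rw [uIoc_of_le (by linarith)] at hs
    rw [← dist_eq_norm]
    refine (h (show s ∈ Ici t from hs.1.le) ?_).le
    rw [Real.dist_eq, abs_of_pos (by linarith [hs.1])]
    linarith [hs.2]

lemma SolOn.hasDerivAt (hr : 0 ≤ r) (hA : LocFin A) (hf : ContOff n l r D A f)
    (h2 : H2 n l r D f) (hd : MD l D d) {x : ℝ → Euc n} {a b t : ℝ} (hx : SolOn f d x a b)
    (ha : 0 ≤ a) (hat : a < t) (htb : t < b)
    (hc : ContinuousWithinAt (fun s => f s (seg x s) (d s)) (Ici 0) t) :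
    HasDerivAt x (f t (seg x t) (d t)) t := by
  have ht0 : 0 < t := ha.trans_lt hat
  have hc' : ContinuousAt (fun s => f s (seg x s) (d s)) t := hc.continuousAt (Ici_mem_nhds ht0)
  have hi := rhs_intervalIntegrable hr hA hf h2 hd hx.1 ha hat.le
  have hm : StronglyMeasurableAtFilter (fun s => f s (seg x s) (d s)) (nhds t) :=
    ⟨Icc a b, Icc_mem_nhds hat htb, hf.rhs_aestronglyMeasurable hr hA hd hx.1 ha⟩
  have hder := (intervalIntegral.integral_hasDerivAt_right hi hm hc').const_add (x a)
  refine hder.congr_of_eventuallyEq ?_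
  filter_upwards [Icc_mem_nhds hat htb] with s hs
  exact hx.2 a s le_rfl hs.1 hs.2

/-- Continuous dependence on the initial history. -/
lemma H1.continuous_dependence (hr : 0 ≤ r) (h1 : H1 n l r D f) (hA : LocFin A)
    (hf : ContOff n l r D A f) (h2 : H2 n l r D f) (b R : ℝ) (hR : 0 ≤ R) :
    ∃ K, 0 ≤ K ∧ ∀ (d : ℝ → Euc l) (x y : ℝ → Euc n) (a m : ℝ), MD l D d → 0 ≤ a →
      SolOn f d x a b → SolOn f d y a b → (∀ s ∈ Icc (a - r) b, ‖x s‖ ≤ R) →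
      (∀ s ∈ Icc (a - r) b, ‖y s‖ ≤ R) → (∀ s ∈ Icc (a - r) a, ‖x s - y s‖ ^ 2 ≤ m) →
      ∀ t ∈ Icc a b, ‖x t - y t‖ ^ 2 ≤ K * m := by
  obtain ⟨L, -, hLs, hLt, hL0, hL⟩ := h1
  rcases lt_or_ge b 0 with hb0 | hb0
  · exact ⟨0, le_rfl, fun d x y a m _ ha _ _ _ _ _ t ht => by linarith [ht.1, ht.2]⟩
  let Λ : ℝ := L b (R + R) + 1
  have hΛ : 0 < Λ := by have := hL0 b (R + R) hb0 (by linarith); positivity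
  let lam : ℝ := 4 * Λ
  have hlam : 0 < lam := by positivity
  refine ⟨2 * Real.exp (lam * r) * Real.exp (lam * b), by positivity, ?_⟩
  intro d x y a m hd ha hx hy hxR hyR hm t ht
  have hab : a ≤ b := ht.1.trans ht.2
  have hm0 : 0 ≤ m := (sq_nonneg _).trans (hm a ⟨by linarith, le_rfl⟩)
  have hxc := hx.1
  have hyc := hy.1
  let N : ℝ → ℝ := fun s => ‖x s - y s‖ ^ 2 * Real.exp (-(lam * (s - a)))
  have hN : Continuous N := by fun_prop
  obtain ⟨p, hp, hpmax⟩ := (isCompact_Icc (a := a - r) (b := b)).exists_isMaxOn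
    ⟨a, by linarith, hab⟩ hN.continuousOn
  have hNle : ∀ s ∈ Icc (a - r) b, N s ≤ N p := fun s hs => hpmax hs
  have hz : ∀ s ∈ Icc (a - r) b, ‖x s - y s‖ ^ 2 ≤ N p * Real.exp (lam * (s - a)) := by
    intro s hs
    have := mul_le_mul_of_nonneg_right (hNle s hs) (Real.exp_pos (lam * (s - a))).le
    have e : N s * Real.exp (lam * (s - a)) = ‖x s - y s‖ ^ 2 := by
      simp only [N]
      rw [mul_assoc, ← Real.exp_add]
      simp
    rwa [e] at this
  have hNp0 : 0 ≤ N p := by positivity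
  have hexp1 : 1 ≤ Real.exp (lam * r) := Real.one_le_exp (by positivity)
  have hNp : N p ≤ 2 * Real.exp (lam * r) * m := by
    rcases le_or_gt p a with hpa | hpa
    · have e1 := hm p ⟨hp.1, hpa⟩
      have e2 : Real.exp (-(lam * (p - a))) ≤ Real.exp (lam * r) := by
        apply Real.exp_le_exp.2
        nlinarith [hp.1]
      calc N p ≤ m * Real.exp (lam * r) := mul_le_mul e1 e2 (Real.exp_pos _).le hm0
        _ ≤ 2 * Real.exp (lam * r) * m := by nlinarith [mul_nonneg hm0 (Real.exp_pos (lam * r)).le]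
    · obtain ⟨B, hB, hBc⟩ := hf.exists_rhs_continuousWithinAt hr hA hd
      let e' : ℝ → ℝ := fun s =>
        2 * ⟪x s - y s, f s (seg x s) (d s) - f s (seg y s) (d s)⟫
      have hder : ∀ s ∈ Ioo a p \ (B ∩ Icc 0 b),
          HasDerivAt (fun s => ‖x s - y s‖ ^ 2) (e' s) s := by
        intro s hs
        have hs0 : 0 ≤ s := ha.trans hs.1.1.le
        have hsb : s < b := hs.1.2.trans_le hp.2
        have hsB : s ∉ B := fun h => hs.2 ⟨h, hs0, hsb.le⟩
        have hdx := hx.hasDerivAt hr hA hf h2 hd ha hs.1.1 hsb (hBc x hxc s hs0 hsB)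
        have hdy := hy.hasDerivAt hr hA hf h2 hd ha hs.1.1 hsb (hBc y hyc s hs0 hsB)
        exact (hdx.sub hdy).norm_sq
      obtain ⟨Cx, hCx⟩ := h2.exists_rhs_bound hr hd hxc (b := b) ha
      obtain ⟨Cy, hCy⟩ := h2.exists_rhs_bound hr hd hyc (b := b) ha
      have hint : IntervalIntegrable e' volume a p := by
        rw [intervalIntegrable_iff_integrableOn_Icc_of_le hpa.le]
        refine Integrable.of_bound (C := 2 * ((R + R) * (Cx + Cy))) ?_ ?_
        · refine AEStronglyMeasurable.const_mul ?_ 2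
          refine AEStronglyMeasurable.inner (by fun_prop) ?_
          exact (hf.rhs_aestronglyMeasurable hr hA hd hxc ha).sub
            (hf.rhs_aestronglyMeasurable hr hA hd hyc ha)
        · refine (ae_restrict_iff' measurableSet_Icc).2 (Eventually.of_forall fun s hs => ?_)
          have hsb : s ∈ Icc a b := ⟨hs.1, hs.2.trans hp.2⟩
          have hsb' : s ∈ Icc (a - r) b := ⟨by linarith [hs.1], hsb.2⟩
          simp only [e', norm_mul, Real.norm_ofNat]
          gcongr
          refine (norm_inner_le_norm _ _).trans ?_
          have u1 := (norm_sub_le (x s) (y s)).trans (add_le_add (hxR s hsb') (hyR s hsb'))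
          have u2 := (norm_sub_le (f s (seg x s) (d s)) (f s (seg y s) (d s))).trans
            (add_le_add (hCx s hsb) (hCy s hsb))
          exact mul_le_mul u1 u2 (norm_nonneg _) (by linarith)
      have hFTC := integral_eq_of_hasDerivAt_off_countable_of_le (fun s => ‖x s - y s‖ ^ 2) e'
        hpa.le (hB b).countable (by fun_prop) hder hint
      have hle : ∫ s in a..p, e' s ≤ ∫ s in a..p, 2 * Λ * N p * Real.exp (lam * (s - a)) := by
        refine intervalIntegral.integral_mono_on hpa.le hint
          (Continuous.intervalIntegrable (by fun_prop) _ _) fun s hs => ?_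
        have hs0 : 0 ≤ s := ha.trans hs.1
        have hsb : s ≤ b := hs.2.trans hp.2
        have hxs := (continuous_seg hxc s).continuousOn (s := Icc (-r) 0)
        have hys := (continuous_seg hyc s).continuousOn (s := Icc (-r) 0)
        have k1 := hL s (seg x s) (seg y s) (d s) hs0 hxs hys (hd.1 s hs0)
        simp only [seg, add_zero] at k1
        have hmem : ∀ θ ∈ Icc (-r) 0, s + θ ∈ Icc (a - r) b := fun θ hθ =>
          ⟨by linarith [hθ.1, hs.1], by linarith [hθ.2]⟩
        have kx : histNorm n r (seg x s) ≤ R := histNorm_le hr fun θ hθ => hxR _ (hmem θ hθ)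
        have ky : histNorm n r (seg y s) ≤ R := histNorm_le hr fun θ hθ => hyR _ (hmem θ hθ)
        have k2 : L s (histNorm n r (seg x s) + histNorm n r (seg y s)) ≤ Λ := by
          have u1 := hLs s hs0 (add_nonneg (histNorm_nonneg (q := r) (seg x s))
            (histNorm_nonneg (q := r) (seg y s))) (show (0:ℝ) ≤ R + R by linarith)
            (add_le_add kx ky)
          have u2 := hLt (R + R) (by linarith) hs0 hb0 hsb
          linarith
        have k3 : histNorm n r (seg x s - seg y s) ^ 2 ≤ N p * Real.exp (lam * (s - a)) := by
          have hsq : histNorm n r (seg x s - seg y s) ≤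
              Real.sqrt (N p * Real.exp (lam * (s - a))) := by
            refine histNorm_le hr fun θ hθ => Real.le_sqrt_of_sq_le ?_
            refine (hz _ (hmem θ hθ)).trans ?_
            gcongr
            linarith [hθ.2]
          calc _ ≤ Real.sqrt (N p * Real.exp (lam * (s - a))) ^ 2 :=
                pow_le_pow_left₀ (histNorm_nonneg _) hsq 2
            _ = _ := Real.sq_sqrt (by positivity)
        have k4 := mul_le_mul k2 k3 (sq_nonneg _) hΛ.le
        simp only [e']
        linarith [k1.trans k4]
      have hval : ∫ s in a..p, 2 * Λ * N p * Real.exp (lam * (s - a)) =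
          N p / 2 * (Real.exp (lam * (p - a)) - 1) := by
        have hD : ∀ s ∈ uIcc a p, HasDerivAt (fun s => N p / 2 * Real.exp (lam * (s - a)))
            (2 * Λ * N p * Real.exp (lam * (s - a))) s := by
          intro s _
          have := ((((hasDerivAt_id s).sub_const a).const_mul lam).exp).const_mul (N p / 2)
          refine this.congr_deriv ?_
          have e : lam = 4 * Λ := rfl
          rw [e]
          simp only [id]
          ring
        rw [intervalIntegral.integral_eq_sub_of_hasDerivAt hD
          (Continuous.intervalIntegrable (by fun_prop) _ _)]
        simp
        ring
      have hea := hm a ⟨by linarith, le_rfl⟩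
      have hep : ‖x p - y p‖ ^ 2 ≤ m + N p / 2 * Real.exp (lam * (p - a)) := by
        have : ‖x p - y p‖ ^ 2 - ‖x a - y a‖ ^ 2 ≤ N p / 2 * (Real.exp (lam * (p - a)) - 1) := by
          rw [← hval, ← hFTC]; exact hle
        linarith
      have hexpm : Real.exp (-(lam * (p - a))) ≤ 1 :=
        Real.exp_le_one_iff.2 (by have := mul_pos hlam (sub_pos.2 hpa); linarith)
      have : N p ≤ m + N p / 2 := by
        calc N p ≤ (m + N p / 2 * Real.exp (lam * (p - a))) * Real.exp (-(lam * (p - a))) :=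
              mul_le_mul_of_nonneg_right hep (Real.exp_pos _).le
          _ = m * Real.exp (-(lam * (p - a))) + N p / 2 := by
              rw [add_mul, mul_assoc (N p / 2), ← Real.exp_add]
              simp
          _ ≤ m + N p / 2 := by nlinarith
      nlinarith
  have e1 := hz t ⟨by linarith [ht.1], ht.2⟩
  have e2 : Real.exp (lam * (t - a)) ≤ Real.exp (lam * b) :=
    Real.exp_le_exp.2 (mul_le_mul_of_nonneg_left (by linarith [ht.2]) hlam.le)
  calc _ ≤ N p * Real.exp (lam * (t - a)) := e1
    _ ≤ (2 * Real.exp (lam * r) * m) * Real.exp (lam * b) :=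
        mul_le_mul hNp e2 (Real.exp_pos _).le (by positivity)
    _ = _ := by ring

/-- Existence of solutions from an a priori bound. -/
theorem exists_solOn_of_apriori (hr : 0 ≤ r) (hA : LocFin A) (hf : ContOff n l r D A f)
    (hloc : LocalField n l r D f) (h2 : H2 n l r D f) (hd : MD l D d)
    {φ : ℝ → Euc n} (hφ : Continuous φ) {t₀ T R : ℝ} (ht₀ : 0 ≤ t₀) (hT : t₀ ≤ T)
    (hap : ∀ T' ∈ Icc t₀ T, ∀ x, SolOn f d x t₀ T' → (∀ t ≤ t₀, x t = φ t) → ‖x T'‖ ≤ R) :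
    ∃ x, SolOn f d x t₀ T ∧ ∀ t ≤ t₀, x t = φ t := by
  obtain ⟨R₀, hR₀, hφR⟩ := exists_bound_of_continuous hφ (t₀ - r) t₀
  let M := max R R₀
  let χ : ℝ → ℝ := fun s => max 0 (min 1 (M + 2 - s))
  have hχ0 : ∀ s, 0 ≤ χ s := fun s => le_max_left _ _
  have hχ1 : ∀ s, χ s ≤ 1 := fun s => max_le zero_le_one (min_le_left _ _)
  have hχlip : ∀ s t, |χ s - χ t| ≤ |s - t| := by
    intro s t
    refine (abs_max_sub_max_le_max _ _ _ _).trans (max_le (by simp) ?_)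
    refine (abs_min_sub_min_le_max _ _ _ _).trans (max_le (by simp) ?_)
    rw [← abs_neg]
    apply le_of_eq
    congr 1
    ring
  let g : ℝ → (ℝ → Euc n) → Euc l → Euc n := fun t x d => χ (histNorm n r x) • f t x d
  have hg : ContOff n l r D A g := by
    intro t x d₀ ht htA hx hd₀ ε hε
    obtain ⟨δ, hδ, h⟩ := hf t x d₀ ht htA hx hd₀ (ε / 2) (half_pos hε)
    refine ⟨min δ (ε / (2 * (‖f t x d₀‖ + 1))), lt_min hδ (by positivity), ?_⟩
    intro t' x' d' ht' hx' hd' k1 k2 k3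
    have e1 := h t' x' d' ht' hx' hd' (k1.trans_le (min_le_left _ _))
      (k2.trans_le (min_le_left _ _)) (k3.trans_le (min_le_left _ _))
    have e2 := k2.trans_le (min_le_right _ _)
    rw [lt_div_iff₀ (by positivity)] at e2
    have e3 := (hχlip (histNorm n r x') (histNorm n r x)).trans (histNorm_sub_le hr hx' hx)
    have e4 : g t' x' d' - g t x d₀ = χ (histNorm n r x') • (f t' x' d' - f t x d₀) +
        (χ (histNorm n r x') - χ (histNorm n r x)) • f t x d₀ := by
      simp only [g, smul_sub, sub_smul]
      abel
    rw [e4]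
    refine (norm_add_le _ _).trans_lt ?_
    rw [norm_smul, norm_smul, Real.norm_of_nonneg (hχ0 _), Real.norm_eq_abs]
    have e5 : χ (histNorm n r x') * ‖f t' x' d' - f t x d₀‖ ≤ ‖f t' x' d' - f t x d₀‖ :=
      mul_le_of_le_one_left (norm_nonneg _) (hχ1 _)
    have e6 : |χ (histNorm n r x') - χ (histNorm n r x)| * ‖f t x d₀‖ ≤
        histNorm n r (x' - x) * (‖f t x d₀‖ + 1) :=
      mul_le_mul e3 (by linarith) (norm_nonneg _) (histNorm_nonneg _)
    linarith
  have hgloc : LocalField n l r D g := by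
    intro t x y d₀ ht hx hd₀ hxy
    simp only [g]
    rw [hloc t x y d₀ ht hx hd₀ hxy, histNorm_congr hxy]
  obtain ⟨C, hC⟩ := h2 T (M + 2)
  obtain ⟨x, hxc, hx0, hx⟩ := exists_solution_of_bounded hr hA hg hgloc hd hφ ht₀ hT
    (C := max C 0) (by
      intro t x d₀ ht htT hx hd₀
      simp only [g]
      rw [norm_smul, Real.norm_of_nonneg (hχ0 _)]
      rcases le_total (histNorm n r x) (M + 2) with h | h
      · exact (mul_le_of_le_one_left (norm_nonneg _) (hχ1 _)).trans
          ((hC t x d₀ ht htT hx h hd₀).trans (le_max_left _ _))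
      · have : χ (histNorm n r x) = 0 := max_eq_left ((min_le_right _ _).trans (by linarith))
        rw [this, zero_mul]
        exact le_max_right _ _)
  have hsol : ∀ s ∈ Icc t₀ T, (∀ u ∈ Icc t₀ s, ‖x u‖ ≤ M + 1) → SolOn f d x t₀ s := by
    intro s hs hbd
    refine SolOn.of_initial hr hA hf h2 hd hxc ht₀ fun t ht => ?_
    rw [hx t ⟨ht.1, ht.2.trans hs.2⟩, hx0 t₀ le_rfl]
    refine congrArg (φ t₀ + ·) (intervalIntegral.integral_congr fun u hu => ?_)
    rw [uIcc_of_le ht.1] at hu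
    have hh : histNorm n r (seg x u) ≤ M + 1 := by
      refine histNorm_le hr fun θ hθ => ?_
      rcases le_total (u + θ) t₀ with h | h
      · show ‖x (u + θ)‖ ≤ _
        rw [hx0 _ h]
        have := hφR (u + θ) ⟨by linarith [hu.1, hθ.1], h⟩
        have := le_max_right R R₀
        simp only [M]
        linarith
      · exact hbd _ ⟨h, by linarith [hu.2, hθ.2, ht.2]⟩
    have h1 : χ (histNorm n r (seg x u)) = 1 := by
      simp only [χ]
      rw [min_eq_left (by linarith), max_eq_right zero_le_one]
    simp only [g, h1, one_smul]
  have hxa : ‖x t₀‖ ≤ M := by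
    rw [hx0 t₀ le_rfl]
    exact (hφR t₀ ⟨by linarith, le_rfl⟩).trans (le_max_right _ _)
  have hle : ∀ t ∈ Icc t₀ T, ‖x t‖ ≤ M := by
    refine le_on_Icc_of_local (w := fun t => ‖x t‖) (B := fun _ => M) ?_ continuousOn_const hxa ?_
    · intro t _ ε hε
      obtain ⟨δ, hδ, h⟩ := Metric.continuous_iff.1 hxc.norm t ε hε
      refine ⟨δ, hδ, fun s _ hs => ?_⟩
      have := h s hs
      rw [Real.dist_eq, abs_lt] at this
      linarith [this.1]
    · intro t ht hbd
      obtain ⟨δ, hδ, h⟩ := Metric.continuous_iff.1 hxc.norm t 1 one_pos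
      refine ⟨δ, hδ, fun s hts hs hsT => ?_⟩
      refine (hap s ⟨ht.1.trans hts.le, hsT⟩ x (hsol s ⟨ht.1.trans hts.le, hsT⟩ ?_) hx0).trans
        (le_max_left _ _)
      intro u hu
      rcases le_or_gt u t with hut | hut
      · linarith [hbd u ⟨hu.1, hut⟩]
      · have k := h u (by rw [Real.dist_eq, abs_of_pos (by linarith)]; linarith [hu.2])
        rw [Real.dist_eq, abs_lt] at k
        linarith [k.2, hbd t ⟨ht.1, le_rfl⟩]
  exact ⟨x, hsol T ⟨hT, le_rfl⟩ fun u hu => by linarith [hle u hu], hx0⟩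

end Solutions

/-- Follow `x` up to time `t` and move along the straight line with velocity `v` afterwards. -/
def lineExt {n : ℕ} (x : ℝ → Euc n) (t : ℝ) (v : Euc n) : ℝ → Euc n :=
  fun s => x (min s t) + max (s - t) 0 • v

section LineExt

variable {n : ℕ} {x : ℝ → Euc n} {t : ℝ} {v : Euc n}

lemma continuous_lineExt (hx : Continuous x) : Continuous (lineExt x t v) := by
  unfold lineExt
  fun_prop

lemma lineExt_of_le {s : ℝ} (hs : s ≤ t) : lineExt x t v s = x s := by
  simp [lineExt, min_eq_left hs, max_eq_right (sub_nonpos.2 hs)]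

lemma lineExt_of_ge {s : ℝ} (hs : t ≤ s) : lineExt x t v s = x t + (s - t) • v := by
  simp [lineExt, min_eq_right hs, max_eq_left (sub_nonneg.2 hs)]

lemma Eop_seg (h : ℝ) : Eop n (seg x t) h v = seg (lineExt x t v) (t + h) := by
  funext θ
  simp only [Eop, seg]
  split_ifs with hθ
  · rw [lineExt_of_ge (by linarith), add_zero]
    congr 2
    ring
  · rw [lineExt_of_le (by linarith)]
    congr 1
    ring

end LineExt

lemma Vdot_lt_step {n : ℕ} {q : ℝ} {V : ℝ → (ℝ → Euc n) → ℝ} {t c : ℝ} {x : ℝ → Euc n}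
    {v : Euc n} (hV : Vdot n q V t x v < (c : EReal)) :
    ∃ δ > 0, ∀ h y, 0 < h → h < δ → ContinuousOn y (Icc (-q) 0) → histNorm n q y < δ →
      V (t + h) (fun θ => Eop n x h v θ + h • y θ) ≤ V t x + c * h := by
  unfold Vdot at hV
  obtain ⟨δ, hδ⟩ := iInf_lt_iff.1 hV
  refine ⟨δ, δ.2, fun h y h0 hh hy hyn => ?_⟩
  have := (le_iSup (fun p : {p : ℝ × (ℝ → Euc n) //
      0 < p.1 ∧ p.1 < (δ : ℝ) ∧ ContinuousOn p.2 (Icc (-q) 0) ∧ histNorm n q p.2 < (δ : ℝ)} =>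
    (((V (t + p.1.1) (fun θ => Eop n x p.1.1 v θ + p.1.1 • p.1.2 θ) - V t x) / p.1.1 : ℝ) : EReal))
    ⟨(h, y), h0, hh, hy, hyn⟩).trans_lt hδ
  simp only [EReal.coe_lt_coe_iff] at this
  rw [div_lt_iff₀ h0] at this
  linarith

/-- The standing assumptions on the field `f` and on the functional `V`. -/
structure LyapunovSetting (n l : ℕ) (r τ : ℝ) (D : Set (Euc l)) (A : Set ℝ)
    (f : ℝ → (ℝ → Euc n) → Euc l → Euc n) (β : ℝ) (V : ℝ → (ℝ → Euc n) → ℝ)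
    (a₁ : ℝ → ℝ) : Prop where
  hr : 0 ≤ r
  hτ : 0 ≤ τ
  hA : LocFin A
  hf : ContOff n l r D A f
  hloc : LocalField n l r D f
  h1 : H1 n l r D f
  h2 : H2 n l r D f
  hβ : 0 ≤ β
  hVnn : ∀ t x, 0 ≤ t → ContinuousOn x (Icc (-(r + τ)) 0) → 0 ≤ V t x
  hVlsc : ∀ t x, 0 ≤ t → ContinuousOn x (Icc (-(r + τ)) 0) → ∀ ε > 0, ∃ δ > 0,
      ∀ t' x', 0 ≤ t' → ContinuousOn x' (Icc (-(r + τ)) 0) →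
        |t' - t| + histNorm n (r + τ) (x' - x) < δ → V t x - ε < V t' x'
  ha₁ : IsKInf a₁
  hlower : ∀ t x, 0 ≤ t → ContinuousOn x (Icc (-(r + τ)) 0) → a₁ ‖x 0‖ ≤ V t x
  hgrowth : ∀ t x d, 0 ≤ t → ContinuousOn x (Icc (-(r + τ)) 0) → d ∈ D →
      Vdot n (r + τ) V t x (f t x d) ≤ ((β * V t x : ℝ) : EReal)

namespace LyapunovSetting

variable {n l : ℕ} {r τ : ℝ} {D : Set (Euc l)} {A : Set ℝ}
  {f : ℝ → (ℝ → Euc n) → Euc l → Euc n} {β : ℝ} {V : ℝ → (ℝ → Euc n) → ℝ} {a₁ : ℝ → ℝ}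
  {d : ℝ → Euc l} {x : ℝ → Euc n} {a b t : ℝ}

lemma nonneg_along (S : LyapunovSetting n l r τ D A f β V a₁) (hx : Continuous x) (ht : 0 ≤ t) :
    0 ≤ V t (seg x t) :=
  S.hVnn t _ ht (continuous_seg hx t).continuousOn

lemma lower_along (S : LyapunovSetting n l r τ D A f β V a₁) (hx : Continuous x) (ht : 0 ≤ t) :
    a₁ ‖x t‖ ≤ V t (seg x t) := by
  simpa [seg] using S.hlower t (seg x t) ht (continuous_seg hx t).continuousOn

lemma lsc_along (S : LyapunovSetting n l r τ D A f β V a₁) (hx : Continuous x) (ht : 0 ≤ t)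
    {ε : ℝ} (hε : 0 < ε) :
    ∃ δ > 0, ∀ s, 0 ≤ s → |s - t| < δ → V t (seg x t) - ε < V s (seg x s) := by
  obtain ⟨δ, hδ, h⟩ := S.hVlsc t (seg x t) ht (continuous_seg hx t).continuousOn ε hε
  have hq : 0 ≤ r + τ := add_nonneg S.hr S.hτ
  obtain ⟨η, hη, hη'⟩ := Metric.eventually_nhds_iff.1
    ((tendsto_histNorm_seg_sub hq hx t).eventually (gt_mem_nhds (half_pos hδ)))
  refine ⟨min η (δ / 2), lt_min hη (half_pos hδ), fun s hs hst => ?_⟩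
  refine h s _ hs (continuous_seg hx s).continuousOn ?_
  have e1 := hη' (y := s) (by rw [Real.dist_eq]; exact hst.trans_le (min_le_left _ _))
  have e2 := hst.trans_le (min_le_right _ _)
  linarith

/-- At a regular time the generalized derivative controls the growth of `V` along solutions. -/
lemma step_along (S : LyapunovSetting n l r τ D A f β V a₁) (hd : MD l D d)
    (hx : SolOn f d x a b) (ha : 0 ≤ a) (hat : a ≤ t) (htb : t < b) (htA : t ∉ A) {c : ℝ}
    (hc : Vdot n (r + τ) V t (seg x t) (f t (seg x t) (d t)) < (c : EReal)) :
    ∃ δ > 0, ∀ u, t < u → u < t + δ → V u (seg x u) ≤ V t (seg x t) + c * (u - t) := by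
  have hq : 0 ≤ r + τ := add_nonneg S.hr S.hτ
  obtain ⟨δ, hδ, hstep⟩ := Vdot_lt_step hc
  obtain ⟨η, hη, hslope⟩ := hx.right_slope S.hr S.hA S.hf S.h2 hd ha hat htb htA (half_pos hδ)
  refine ⟨min δ η, lt_min hδ hη, fun u htu hu => ?_⟩
  obtain ⟨h, rfl⟩ : ∃ h, u = t + h := ⟨u - t, by ring⟩
  have h0 : 0 < h := by linarith
  have hhδ : h < δ := by linarith [min_le_left δ η]
  have hhη : h < η := by linarith [min_le_right δ η]
  set v := f t (seg x t) (d t) with hv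
  let y : ℝ → Euc n := fun θ => h⁻¹ • (seg x (t + h) θ - seg (lineExt x t v) (t + h) θ)
  have hyc : Continuous y := by
    have h1 := continuous_seg hx.1 (t + h)
    have h2 := continuous_seg (continuous_lineExt (t := t) (v := v) hx.1) (t + h)
    exact (h1.sub h2).const_smul h⁻¹
  have hyn : histNorm n (r + τ) y < δ := by
    refine lt_of_le_of_lt (histNorm_le hq fun θ hθ => ?_) (half_lt_self hδ)
    simp only [y, seg]
    rw [norm_smul, norm_inv, Real.norm_of_nonneg h0.le, inv_mul_le_iff₀ h0]
    rcases le_total (t + h + θ) t with hle | hle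
    · rw [lineExt_of_le hle, sub_self, norm_zero]
      positivity
    · rw [lineExt_of_ge hle]
      have := hslope (h + θ) (by linarith) (by linarith [hθ.2])
      rw [show t + h + θ = t + (h + θ) by ring, add_sub_cancel_left, ← sub_sub]
      refine this.trans ?_
      nlinarith [hθ.2]
  have := hstep h y h0 hhδ hyc.continuousOn hyn
  rw [Eop_seg] at this
  have e : (fun θ => seg (lineExt x t v) (t + h) θ + h • y θ) = seg x (t + h) := by
    funext θ
    simp only [y]
    rw [smul_inv_smul₀ h0.ne']
    abel
  rw [e] at this
  simpa using this

/-- Exponential growth bound on an interval without exceptional times. -/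
lemma growth_of_regular (S : LyapunovSetting n l r τ D A f β V a₁) (hd : MD l D d)
    (hx : SolOn f d x a b) (ha : 0 ≤ a) (hreg : ∀ t ∈ Ico a b, t ∉ A) :
    ∀ t ∈ Icc a b, V t (seg x t) ≤ Real.exp ((β + 1) * (t - a)) * V a (seg x a) := by
  intro t₁ ht₁
  have key : ∀ ε > 0, V t₁ (seg x t₁) ≤
      (V a (seg x a) + ε) * Real.exp ((β + 1) * (t₁ - a)) - ε := by
    intro ε hε
    refine le_on_Icc_of_local (w := fun t => V t (seg x t))
      (B := fun t => (V a (seg x a) + ε) * Real.exp ((β + 1) * (t - a)) - ε) (a := a) (b := b)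
      ?_ (by fun_prop) (by simp) ?_ t₁ ht₁
    · intro t ht η hη
      obtain ⟨δ, hδ, h⟩ := S.lsc_along hx.1 (ha.trans ht.1.le) hη
      exact ⟨δ, hδ, fun s hs hst => h s (ha.trans hs.1) hst⟩
    · intro t ht hle
      have ht0 : 0 ≤ t := ha.trans ht.1
      have hwB := hle t ⟨ht.1, le_rfl⟩
      have hw0 := S.nonneg_along hx.1 ht0
      have hlt : Vdot n (r + τ) V t (seg x t) (f t (seg x t) (d t)) <
          ((β * V t (seg x t) + ε : ℝ) : EReal) :=
        (S.hgrowth t _ _ ht0 (continuous_seg hx.1 t).continuousOn (hd.1 t ht0)).trans_lt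
          (EReal.coe_lt_coe_iff.2 (by linarith))
      obtain ⟨δ, hδ, h⟩ := S.step_along hd hx ha ht.1 ht.2 (hreg t ht) hlt
      refine ⟨δ, hδ, fun s hts hs _ => ?_⟩
      have e1 := h s hts hs
      have e2 := Real.add_one_le_exp ((β + 1) * (s - t))
      have e3 : Real.exp ((β + 1) * (s - a)) =
          Real.exp ((β + 1) * (t - a)) * Real.exp ((β + 1) * (s - t)) := by
        rw [← Real.exp_add]; congr 1; ring
      rw [e3, ← mul_assoc]
      have e4 : V t (seg x t) + ε ≤ (V a (seg x a) + ε) * Real.exp ((β + 1) * (t - a)) := by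
        linarith
      have e5 := mul_le_mul e4 e2 (by nlinarith [S.hβ]) (by linarith)
      nlinarith [mul_nonneg S.hβ hε.le, mul_nonneg (mul_nonneg S.hβ hε.le) (sub_pos.2 hts).le,
        mul_nonneg hw0 (sub_pos.2 hts).le]
  have hlim : Tendsto (fun ε : ℝ => (V a (seg x a) + ε) * Real.exp ((β + 1) * (t₁ - a)) - ε)
      (nhdsWithin 0 (Ioi 0)) (nhds (Real.exp ((β + 1) * (t₁ - a)) * V a (seg x a))) := by
    have : Continuous fun ε : ℝ => (V a (seg x a) + ε) * Real.exp ((β + 1) * (t₁ - a)) - ε := by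
      fun_prop
    have h := (this.tendsto 0).mono_left (nhdsWithin_le_nhds (s := Ioi 0))
    simpa [mul_comm] using h
  exact ge_of_tendsto hlim (eventually_mem_nhdsWithin.mono fun ε hε => key ε hε)

lemma exists_norm_bound (ha₁ : IsKInf a₁) (M : ℝ) : ∃ R, 0 ≤ R ∧ ∀ s, a₁ s ≤ M → s ≤ R := by
  obtain ⟨R, hR⟩ := (ha₁.2.2.2.2.eventually_gt_atTop M).exists_forall_of_atTop
  refine ⟨max R 0, le_max_right _ _, fun s hs => ?_⟩
  by_contra hlt
  exact absurd (hR s ((le_max_left R 0).trans (not_le.1 hlt).le)) (not_lt.2 hs)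

/-- Growth bound to the right of an arbitrary time. An exceptional time `t` is handled by
following the straight line with velocity `f(t, T_r(t)x, d(t))` for a short time `h` and a solution
afterwards, and by letting `h` tend to zero. -/
lemma local_growth (S : LyapunovSetting n l r τ D A f β V a₁) (hd : MD l D d)
    (hx : SolOn f d x a b) (ha : 0 ≤ a) (hat : a ≤ t) (htb : t < b) :
    ∃ δ > 0, ∀ u, t < u → u < t + δ →
      V u (seg x u) ≤ Real.exp ((β + 1) * (u - t)) * V t (seg x t) := by
  have hr := S.hr
  have hτ := S.hτ
  have hq : 0 ≤ r + τ := add_nonneg S.hr S.hτ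
  have ht0 : 0 ≤ t := ha.trans hat
  obtain ⟨δ₀, hδ₀, hgap⟩ := S.hA.exists_gap ht0
  set v := f t (seg x t) (d t) with hv
  let y := lineExt x t v
  have hyc : Continuous y := continuous_lineExt hx.1
  set w := V t (seg x t) with hw
  have hw0 : 0 ≤ w := S.nonneg_along hx.1 ht0
  have hβ := S.hβ
  let c := β * w + 1
  have hc0 : 0 ≤ c := by positivity
  have hlt : Vdot n (r + τ) V t (seg x t) v < (c : EReal) :=
    (S.hgrowth t _ _ ht0 (continuous_seg hx.1 t).continuousOn (hd.1 t ht0)).trans_lt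
      (EReal.coe_lt_coe_iff.2 (by simp [c, hw]))
  obtain ⟨δ₁, hδ₁, hstep⟩ := Vdot_lt_step hlt
  have hstep' : ∀ h, 0 < h → h < δ₁ → V (t + h) (seg y (t + h)) ≤ w + c * h := by
    intro h h0 hh
    have := hstep h (fun _ => 0) h0 hh continuousOn_const
      (lt_of_le_of_lt (histNorm_le hq fun θ _ => by simp) hδ₁)
    simpa [Eop_seg] using this
  refine ⟨min δ₀ (b - t), lt_min hδ₀ (by linarith), fun u htu hu => ?_⟩
  have hu1 : u < t + δ₀ := by linarith [min_le_left δ₀ (b - t)]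
  have hu2 : u < b := by linarith [min_le_right δ₀ (b - t)]
  let E := Real.exp ((β + 1) * (u - t))
  have hE : 0 < E := Real.exp_pos _
  obtain ⟨R₀, hR₀, hR₀'⟩ := exists_norm_bound S.ha₁ (E * (w + c * (u - t)))
  obtain ⟨Rx, hRx, hRx'⟩ := exists_bound_of_continuous hx.1 (t - r) u
  obtain ⟨Ry, hRy, hRy'⟩ := exists_bound_of_continuous hyc (t - r) u
  let R := R₀ + Rx + Ry
  obtain ⟨K, hK, hdep⟩ := S.h1.continuous_dependence hr S.hA S.hf S.h2 u R (by positivity)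
  refine le_of_forall_pos_le_add fun ε hε => ?_
  obtain ⟨δ₃, hδ₃, hlsc⟩ := S.hVlsc u (seg x u) (ht0.trans htu.le)
    (continuous_seg hx.1 u).continuousOn (ε / 2) (half_pos hε)
  let η := δ₃ / (2 * (K + 1))
  have hη : 0 < η := by positivity
  have hKη : K * η ^ 2 ≤ (δ₃ / 2) ^ 2 ∧ η ≤ δ₃ / 2 := by
    have e : (K + 1) * η = δ₃ / 2 := by simp only [η]; field_simp
    have e1 : η ≤ δ₃ / 2 := by nlinarith
    refine ⟨?_, e1⟩
    have e2 : K * η ≤ δ₃ / 2 := by nlinarith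
    nlinarith [mul_le_mul e2 e1 hη.le (half_pos hδ₃).le]
  obtain ⟨δ₂, hδ₂, hnear⟩ : ∃ δ₂ > 0, ∀ s, s < t + δ₂ → ‖y s - x s‖ ≤ η := by
    have hcont : Continuous fun s => ‖y s - x s‖ := (hyc.sub hx.1).norm
    obtain ⟨δ₂, hδ₂, h⟩ := Metric.continuous_iff.1 hcont t η hη
    refine ⟨δ₂, hδ₂, fun s hs => ?_⟩
    rcases le_or_gt s t with hst | hst
    · simp only [y]
      rw [lineExt_of_le hst, sub_self, norm_zero]
      exact hη.le
    · have := h s (by rw [Real.dist_eq, abs_of_pos (by linarith)]; linarith)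
      have hyt : y t = x t := lineExt_of_le le_rfl
      rw [hyt, sub_self, norm_zero, Real.dist_eq, sub_zero, abs_norm] at this
      exact this.le
  obtain ⟨h, h0, hh⟩ : ∃ h, 0 < h ∧ h < min (min δ₁ δ₂) (min (u - t) (ε / (2 * (E * c + 1)))) :=
    exists_between (lt_min (lt_min hδ₁ hδ₂) (lt_min (by linarith) (by positivity)))
  have hh1 : h < δ₁ := hh.trans_le ((min_le_left _ _).trans (min_le_left _ _))
  have hh2 : h < δ₂ := hh.trans_le ((min_le_left _ _).trans (min_le_right _ _))
  have hh3 : h < u - t := hh.trans_le ((min_le_right _ _).trans (min_le_left _ _))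
  have hh4 : h < ε / (2 * (E * c + 1)) :=
    hh.trans_le ((min_le_right _ _).trans (min_le_right _ _))
  rw [lt_div_iff₀ (by positivity)] at hh4
  have hth0 : 0 ≤ t + h := by linarith
  have hVz : ∀ T' ∈ Icc (t + h) u, ∀ z, SolOn f d z (t + h) T' → (∀ s ≤ t + h, z s = y s) →
      V T' (seg z T') ≤ E * (w + c * h) := by
    intro T' hT' z hz hzy
    have e1 := S.growth_of_regular hd hz hth0
      (fun s hs => hgap s (by linarith [hs.1]) (by linarith [hs.2, hT'.2])) T' ⟨hT'.1, le_rfl⟩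
    have e2 : V (t + h) (seg z (t + h)) ≤ w + c * h := by
      have hVloc : V (t + h) (seg z (t + h)) ≤ V (t + h) (seg y (t + h)) := by
        refine le_of_forall_pos_le_add fun ε' hε' => ?_
        obtain ⟨κ, hκ, hk⟩ := S.hVlsc (t + h) (seg z (t + h)) hth0
          (continuous_seg hz.1 _).continuousOn ε' hε'
        have hzero : histNorm n (r + τ) (seg y (t + h) - seg z (t + h)) ≤ 0 := by
          refine histNorm_le hq fun θ hθ => ?_
          have := hzy (t + h + θ) (by linarith [hθ.2])
          simp [seg, this]
        have := hk (t + h) (seg y (t + h)) hth0 (continuous_seg hyc _).continuousOn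
          (by rw [sub_self, abs_zero]; linarith)
        linarith
      exact hVloc.trans (hstep' h h0 hh1)
    refine e1.trans (mul_le_mul ?_ e2 (S.nonneg_along hz.1 hth0) hE.le)
    exact Real.exp_le_exp.2 (mul_le_mul_of_nonneg_left (by linarith [hT'.2]) (by linarith))
  have hVz' : ∀ T' ∈ Icc (t + h) u, ∀ z, SolOn f d z (t + h) T' → (∀ s ≤ t + h, z s = y s) →
      ‖z T'‖ ≤ R₀ := by
    intro T' hT' z hz hzy
    refine hR₀' _ ((S.lower_along hz.1 (hth0.trans hT'.1)).trans
      ((hVz T' hT' z hz hzy).trans ?_))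
    gcongr
  obtain ⟨z, hz, hzy⟩ := exists_solOn_of_apriori hr S.hA S.hf S.hloc S.h2 hd hyc hth0
    (by linarith : t + h ≤ u) hVz'
  have hzR : ∀ s ∈ Icc (t + h - r) u, ‖z s‖ ≤ R := by
    intro s hs
    rcases le_total s (t + h) with hle | hle
    · rw [hzy s hle]
      have := hRy' s ⟨by linarith [hs.1], hs.2⟩
      simp only [R]
      linarith
    · have := hVz' s ⟨hle, hs.2⟩ z (hz.mono le_rfl hs.2) hzy
      simp only [R]
      linarith
  have hxR : ∀ s ∈ Icc (t + h - r) u, ‖x s‖ ≤ R := by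
    intro s hs
    have := hRx' s ⟨by linarith [hs.1], hs.2⟩
    simp only [R]
    linarith
  have hzx := hdep d z x (t + h) (η ^ 2) hd hth0 hz (hx.mono (by linarith) hu2.le) hzR hxR
    (fun s hs => by
      rw [hzy s hs.2]
      exact pow_le_pow_left₀ (norm_nonneg _) (hnear s (by linarith [hs.2])) 2)
  have hclose : histNorm n (r + τ) (seg z u - seg x u) ≤ δ₃ / 2 := by
    refine histNorm_le hq fun θ hθ => ?_
    show ‖z (u + θ) - x (u + θ)‖ ≤ _
    rcases le_total (u + θ) (t + h) with hle | hle
    · rw [hzy _ hle]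
      exact (hnear _ (by linarith)).trans hKη.2
    · exact le_of_sq_le_sq ((hzx _ ⟨hle, by linarith [hθ.2]⟩).trans hKη.1) (half_pos hδ₃).le
  have e1 := hlsc u (seg z u) (ht0.trans htu.le) (continuous_seg hz.1 u).continuousOn
    (by rw [sub_self, abs_zero]; linarith)
  have e2 := hVz u ⟨by linarith, le_rfl⟩ z hz hzy
  show V u (seg x u) ≤ E * w + ε
  nlinarith

/-- Exponential growth bound for `V` along solutions. -/
lemma growth (S : LyapunovSetting n l r τ D A f β V a₁) (hd : MD l D d)
    (hx : SolOn f d x a b) (ha : 0 ≤ a) :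
    ∀ t ∈ Icc a b, V t (seg x t) ≤ Real.exp ((β + 1) * (t - a)) * V a (seg x a) := by
  refine le_on_Icc_of_local (w := fun t => V t (seg x t))
    (B := fun t => Real.exp ((β + 1) * (t - a)) * V a (seg x a))
    ?_ (by fun_prop) (by simp) ?_
  · intro t ht η hη
    obtain ⟨δ, hδ, h⟩ := S.lsc_along hx.1 (ha.trans ht.1.le) hη
    exact ⟨δ, hδ, fun s hs hst => h s (ha.trans hs.1) hst⟩
  · intro t ht hle
    obtain ⟨δ, hδ, h⟩ := S.local_growth hd hx ha ht.1 ht.2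
    refine ⟨δ, hδ, fun s hts hs _ => (h s hts hs).trans ?_⟩
    have e := mul_le_mul_of_nonneg_left (hle t ⟨ht.1, le_rfl⟩)
      (Real.exp_pos ((β + 1) * (s - t))).le
    refine e.trans (le_of_eq ?_)
    rw [← mul_assoc, ← Real.exp_add]
    congr 2
    ring

lemma exists_solOn (S : LyapunovSetting n l r τ D A f β V a₁) (hd : MD l D d)
    {φ : ℝ → Euc n} (hφ : Continuous φ) {t₀ T : ℝ} (ht₀ : 0 ≤ t₀) (hT : t₀ ≤ T) :
    ∃ x, SolOn f d x t₀ T ∧ ∀ t ≤ t₀, x t = φ t := by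
  have hβ := S.hβ
  have hq : 0 ≤ r + τ := add_nonneg S.hr S.hτ
  obtain ⟨R, -, hR⟩ := exists_norm_bound S.ha₁
    (Real.exp ((β + 1) * (T - t₀)) * (V t₀ (seg φ t₀) + 1))
  refine exists_solOn_of_apriori S.hr S.hA S.hf S.hloc S.h2 hd hφ ht₀ hT (R := R) ?_
  intro T' hT' x hx hxφ
  refine hR _ ((S.lower_along hx.1 (ht₀.trans hT'.1)).trans
    ((S.growth hd hx ht₀ T' ⟨hT'.1, le_rfl⟩).trans ?_))
  refine mul_le_mul (Real.exp_le_exp.2 (mul_le_mul_of_nonneg_left (by linarith [hT'.2])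
    (by linarith))) ?_ (S.nonneg_along hx.1 ht₀) (Real.exp_pos _).le
  obtain ⟨κ, hκ, hk⟩ := S.hVlsc t₀ (seg x t₀) ht₀ (continuous_seg hx.1 _).continuousOn 1 one_pos
  have hzero : histNorm n (r + τ) (seg φ t₀ - seg x t₀) ≤ 0 := by
    refine histNorm_le hq fun θ hθ => ?_
    simp [seg, hxφ (t₀ + θ) (by linarith [hθ.2])]
  have := hk t₀ (seg φ t₀) ht₀ (continuous_seg hφ _).continuousOn
    (by rw [sub_self, abs_zero]; linarith)
  linarith

/-- Solutions with the same initial history coincide. -/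
lemma unique (S : LyapunovSetting n l r τ D A f β V a₁) (hd : MD l D d) {y : ℝ → Euc n}
    (ha : 0 ≤ a) (hx : SolOn f d x a b) (hy : SolOn f d y a b)
    (hxy : ∀ s ∈ Icc (a - r) a, x s = y s) :
    ∀ t ∈ Icc a b, x t = y t := by
  intro t ht
  obtain ⟨Rx, hRx, hRx'⟩ := exists_bound_of_continuous hx.1 (a - r) b
  obtain ⟨Ry, hRy, hRy'⟩ := exists_bound_of_continuous hy.1 (a - r) b
  obtain ⟨K, -, hdep⟩ := S.h1.continuous_dependence S.hr S.hA S.hf S.h2 b (max Rx Ry)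
    (hRx.trans (le_max_left _ _))
  have := hdep d x y a 0 hd ha hx hy (fun s hs => (hRx' s hs).trans (le_max_left _ _))
    (fun s hs => (hRy' s hs).trans (le_max_right _ _)) (fun s hs => by simp [hxy s hs]) t ht
  rw [mul_zero] at this
  have h0 : ‖x t - y t‖ = 0 := by
    have := le_antisymm this (sq_nonneg _)
    exact pow_eq_zero_iff two_ne_zero |>.1 this
  exact sub_eq_zero.1 (norm_eq_zero.1 h0)

end LyapunovSetting

/-- Decay towards the level `μ` at speed `P`, on an interval without exceptional times. -/
lemma decay_of_regular {w ρ : ℝ → ℝ} {a b m μ M P : ℝ}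
    (hlsc : ∀ t ∈ Ioc a b, ∀ ε > 0, ∃ δ > 0, ∀ s ∈ Icc a b, |s - t| < δ → w t - ε < w s)
    (hstep : ∀ t ∈ Ico a b, ∀ c, -ρ (w t) < c →
      ∃ δ > 0, ∀ u, t < u → u < t + δ → w u ≤ w t + c * (u - t))
    (hρ : ∀ t ∈ Ico a b, 0 ≤ ρ (w t)) (hP : 0 ≤ P) (hPρ : ∀ u ∈ Icc μ M, P < ρ u)
    (hμM : μ ≤ M) (hm : w a ≤ m) (hmM : m ≤ M) :
    ∀ t ∈ Icc a b, w t ≤ max μ (m - P * (t - a)) := by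
  refine le_on_Icc_of_local (B := fun t => max μ (m - P * (t - a))) hlsc (by fun_prop)
    (by simp [hm]) ?_
  intro t ht hle
  have hwt := hle t ⟨ht.1, le_rfl⟩
  rcases lt_or_ge (w t) μ with hlt | hge
  · obtain ⟨δ, hδ, h⟩ := hstep t ht 1 (by linarith [hρ t ht])
    refine ⟨min δ (μ - w t), lt_min hδ (by linarith), fun u htu hu _ => ?_⟩
    have := h u htu (by linarith [min_le_left δ (μ - w t)])
    exact le_max_of_le_left (by linarith [min_le_right δ (μ - w t)])
  · have hwM : w t ≤ M := hwt.trans (max_le hμM (by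
      have := mul_nonneg hP (sub_nonneg.2 ht.1)
      linarith))
    obtain ⟨δ, hδ, h⟩ := hstep t ht (-P) (by linarith [hPρ (w t) ⟨hge, hwM⟩])
    refine ⟨δ, hδ, fun u htu hu _ => ?_⟩
    have h1 := h u htu hu
    have h2 := mul_nonneg hP (sub_pos.2 htu).le
    rcases le_max_iff.1 hwt with h3 | h3
    · exact le_max_of_le_left (by linarith)
    · exact le_max_of_le_right (by linarith)

/-- Decay towards the level `μ` at speed `P`. At exceptional times only a growth bound is known. -/
lemma decay {A : Set ℝ} (hA : LocFin A) {w ρ : ℝ → ℝ} {a b k μ M P : ℝ} (ha : 0 ≤ a)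
    (hlsc : ∀ t ∈ Icc a b, ∀ ε > 0, ∃ δ > 0, ∀ s ∈ Icc a b, |s - t| < δ → w t - ε < w s)
    (hstep : ∀ t ∈ Ico a b, t ∉ A → ∀ c, -ρ (w t) < c →
      ∃ δ > 0, ∀ u, t < u → u < t + δ → w u ≤ w t + c * (u - t))
    (hgrow : ∀ t ∈ Ico a b, ∃ δ > 0, ∀ u, t < u → u < t + δ →
      w u ≤ Real.exp (k * (u - t)) * w t)
    (hρ : ∀ t ∈ Ico a b, 0 ≤ ρ (w t)) (hP : 0 ≤ P) (hPρ : ∀ u ∈ Icc μ M, P < ρ u)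
    (hμM : μ < M) (hwM : w a < M) :
    ∀ t ∈ Icc a b, w t ≤ max μ (w a - P * (t - a)) := by
  refine le_on_Icc_of_local (B := fun t => max μ (w a - P * (t - a)))
    (fun t ht => hlsc t ⟨ht.1.le, ht.2⟩) (by fun_prop) (by simp) ?_
  intro t ht hle
  have hwt := hle t ⟨ht.1, le_rfl⟩
  have hwtM : w t < M := hwt.trans_lt (max_lt hμM (by
    have := mul_nonneg hP (sub_nonneg.2 ht.1)
    linarith))
  obtain ⟨δ₀, hδ₀, hgap⟩ := hA.exists_gap (ha.trans ht.1)
  obtain ⟨δ₁, hδ₁, hg⟩ := hgrow t ht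
  refine ⟨min δ₀ δ₁, lt_min hδ₀ hδ₁, fun u htu hu hub => ?_⟩
  have hu0 : u < t + δ₀ := by linarith [min_le_left δ₀ δ₁]
  have hu1 : u < t + δ₁ := by linarith [min_le_right δ₀ δ₁]
  have hlim : w u ≤ max μ (w t - P * (u - t)) := by
    have hc : Continuous fun s => Real.exp (k * (s - t)) * w t := by fun_prop
    have hev : ∀ᶠ s in nhdsWithin t (Ioi t), Real.exp (k * (s - t)) * w t < M :=
      ((hc.tendsto t).mono_left nhdsWithin_le_nhds).eventually
        (gt_mem_nhds (by simpa using hwtM))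
    have hc2 : Continuous fun s => max μ (Real.exp (k * (s - t)) * w t - P * (u - s)) := by
      fun_prop
    have h2 := (hc2.tendsto t).mono_left (nhdsWithin_le_nhds (s := Ioi t))
    simp only [sub_self, mul_zero, Real.exp_zero, one_mul] at h2
    refine ge_of_tendsto h2 ?_
    filter_upwards [hev, Ioo_mem_nhdsGT htu] with s hs hsu
    refine decay_of_regular (w := w) (ρ := ρ) (a := s) (b := u) (M := M) ?_ ?_ ?_ hP hPρ hμM.le
      (hg s hsu.1 (by linarith [hsu.2])) hs.le u ⟨hsu.2.le, le_rfl⟩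
    · intro v hv ε hε
      obtain ⟨δ, hδ, h⟩ := hlsc v ⟨by linarith [ht.1, hv.1, hsu.1], hv.2.trans hub⟩ ε hε
      exact ⟨δ, hδ, fun z hz => h z ⟨by linarith [ht.1, hz.1, hsu.1], hz.2.trans hub⟩⟩
    · intro v hv
      exact hstep v ⟨by linarith [ht.1, hv.1, hsu.1], hv.2.trans_le hub⟩
        (hgap v (hsu.1.trans_le hv.1) (hv.2.trans hu0))
    · intro v hv
      exact hρ v ⟨by linarith [ht.1, hv.1, hsu.1], hv.2.trans_le hub⟩
  have h2 := mul_nonneg hP (sub_pos.2 htu).le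
  refine hlim.trans (max_le (le_max_left _ _) ?_)
  rcases le_max_iff.1 hwt with h3 | h3
  · exact le_max_of_le_left (by linarith)
  · exact le_max_of_le_right (by linarith)

section Comparison

/-- The minimum of `ρ` over the segment between `w` and `1`. -/
def segMin (ρ : ℝ → ℝ) (w : ℝ) : ℝ := sInf ((fun θ => ρ (w + θ * (1 - w))) '' Icc (0 : ℝ) 1)

variable {ρ : ℝ → ℝ}

lemma continuous_segMin (hρ : Continuous ρ) : Continuous (segMin ρ) :=
  isCompact_Icc.continuous_sInf (f := fun w θ => ρ (w + θ * (1 - w))) (by fun_prop)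

lemma segMin_le (hρ : Continuous ρ) {w u : ℝ} (hu : u ∈ uIcc w 1) : segMin ρ w ≤ ρ u := by
  rw [← segment_eq_uIcc, segment_eq_image'] at hu
  obtain ⟨θ, hθ, rfl⟩ := hu
  exact csInf_le (isCompact_Icc.image (by fun_prop)).bddBelow ⟨θ, hθ, by simp⟩

lemma exists_segMin_eq (hρ : Continuous ρ) (w : ℝ) : ∃ u ∈ uIcc w 1, segMin ρ w = ρ u := by
  obtain ⟨θ, hθ, h⟩ := (isCompact_Icc.image
    (by fun_prop : Continuous fun θ => ρ (w + θ * (1 - w)))).sInf_mem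
      ((nonempty_Icc.2 zero_le_one).image _)
  refine ⟨w + θ * (1 - w), ?_, h.symm⟩
  rw [← segment_eq_uIcc, segment_eq_image']
  exact ⟨θ, hθ, by simp⟩

lemma segMin_le_segMin (hρ : Continuous ρ) {v w : ℝ} (h : w ∈ uIcc v 1) :
    segMin ρ v ≤ segMin ρ w := by
  obtain ⟨u, hu, e⟩ := exists_segMin_eq hρ w
  rw [e]
  exact segMin_le hρ (uIcc_subset_uIcc h right_mem_uIcc hu)

lemma segMin_pos (hρ : Continuous ρ) (hpos : ∀ s, 0 < s → 0 < ρ s) {w : ℝ} (hw : 0 < w) :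
    0 < segMin ρ w := by
  obtain ⟨u, hu, e⟩ := exists_segMin_eq hρ w
  rw [e]
  exact hpos u ((lt_min hw one_pos).trans_le hu.1)

lemma segMin_nonneg (hρ : Continuous ρ) (hnn : ∀ s, 0 ≤ s → 0 ≤ ρ s) {w : ℝ} (hw : 0 ≤ w) :
    0 ≤ segMin ρ w := by
  obtain ⟨u, hu, e⟩ := exists_segMin_eq hρ w
  rw [e]
  exact hnn u ((le_min hw zero_le_one).trans hu.1)

/-- A positive definite continuous function is bounded below by the product of a `K∞` function
and a positive non-increasing one. -/
lemma exists_product_minorant (hρ : Continuous ρ) (hnn : ∀ s, 0 ≤ s → 0 ≤ ρ s)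
    (hpos : ∀ s, 0 < s → 0 < ρ s) :
    ∃ q c : ℝ → ℝ, IsKInf q ∧ ContinuousOn c (Ici 0) ∧ AntitoneOn c (Ici 0) ∧
      (∀ M, 0 ≤ M → 0 < c M ∧ c M ≤ 1) ∧
      ∀ w u M, 0 < w → w ≤ u → u ≤ M → q w * c M ≤ ρ u := by
  have h1 : 0 < ρ 1 := hpos 1 one_pos
  have hle1 : ∀ w, segMin ρ w ≤ ρ 1 := fun w => segMin_le hρ right_mem_uIcc
  have hcont := continuous_segMin hρ
  have hq0 : ∀ s, 0 ≤ s → 0 ≤ segMin ρ (min s 1) := fun s hs =>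
    segMin_nonneg hρ hnn (le_min hs zero_le_one)
  have hc0 : ∀ M, 0 < segMin ρ (max M 1) := fun M =>
    segMin_pos hρ hpos (one_pos.trans_le (le_max_right _ _))
  refine ⟨fun w => w * segMin ρ (min w 1), fun M => segMin ρ (max M 1) / ((1 + M) * ρ 1),
    ⟨by fun_prop, ?_, by simp, fun s hs => mul_nonneg hs (hq0 s hs), ?_⟩, ?_, ?_, ?_, ?_⟩
  · intro v hv w hw hvw
    have e1 : segMin ρ (min v 1) ≤ segMin ρ (min w 1) := by
      refine segMin_le_segMin hρ ?_
      rw [uIcc_of_le (min_le_right _ _)]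
      exact ⟨min_le_min_right _ hvw.le, min_le_right _ _⟩
    have e2 : 0 < segMin ρ (min w 1) :=
      segMin_pos hρ hpos (lt_min (lt_of_le_of_lt hv hvw) one_pos)
    exact (mul_le_mul_of_nonneg_left e1 hv).trans_lt (mul_lt_mul_of_pos_right hvw e2)
  · have : Tendsto (fun w : ℝ => w * segMin ρ 1) atTop atTop :=
      tendsto_id.atTop_mul_const (segMin_pos hρ hpos one_pos)
    refine this.congr' ?_
    filter_upwards [eventually_ge_atTop 1] with w hw
    rw [min_eq_right hw]
  · refine ContinuousOn.div (by fun_prop) (by fun_prop) fun M hM => ?_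
    have : (0 : ℝ) < 1 + M := by linarith [show (0 : ℝ) ≤ M from hM]
    positivity
  · intro M hM M' hM' hle
    have hM0 : (0 : ℝ) ≤ M := hM
    have hn := (hc0 M').le
    have e1 : segMin ρ (max M' 1) ≤ segMin ρ (max M 1) := by
      refine segMin_le_segMin hρ ?_
      rw [uIcc_of_ge (le_max_right _ _)]
      exact ⟨le_max_right _ _, max_le_max_right _ hle⟩
    show _ / _ ≤ _ / _
    gcongr
    exact hn.trans e1
  · intro M hM
    have := hc0 M
    refine ⟨by positivity, ?_⟩
    rw [div_le_one (by positivity)]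
    nlinarith [hle1 (max M 1)]
  · intro w u M hw hwu huM
    have hM : 0 < 1 + M := by linarith
    have hu : min (segMin ρ (min w 1)) (segMin ρ (max M 1)) ≤ ρ u := by
      rcases le_total u 1 with h | h
      · refine (min_le_left _ _).trans (segMin_le hρ ?_)
        rw [uIcc_of_le (min_le_right _ _)]
        exact ⟨(min_le_left _ _).trans hwu, h⟩
      · refine (min_le_right _ _).trans (segMin_le hρ ?_)
        rw [uIcc_of_ge (le_max_right _ _)]
        exact ⟨h, huM.trans (le_max_left _ _)⟩
    have hprod : segMin ρ (min w 1) * segMin ρ (max M 1) ≤ ρ u * ρ 1 := by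
      rw [← min_mul_max]
      exact mul_le_mul hu (max_le (hle1 _) (hle1 _))
        ((hq0 w hw.le).trans (le_max_left _ _)) (hnn u (hw.le.trans hwu))
    show w * segMin ρ (min w 1) * (segMin ρ (max M 1) / ((1 + M) * ρ 1)) ≤ ρ u
    rw [← mul_div_assoc, div_le_iff₀ (by positivity)]
    have hn : 0 ≤ segMin ρ (min w 1) * segMin ρ (max M 1) := mul_nonneg (hq0 w hw.le) (hc0 M).le
    calc w * segMin ρ (min w 1) * segMin ρ (max M 1)
        = w * (segMin ρ (min w 1) * segMin ρ (max M 1)) := by ring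
      _ ≤ (1 + M) * (ρ u * ρ 1) := mul_le_mul (by linarith) hprod hn hM.le
      _ = _ := by ring

end Comparison

/-- A `K∞` function has a `K∞` inverse. -/
lemma IsKInf.exists_inverse {a : ℝ → ℝ} (ha : IsKInf a) :
    ∃ b : ℝ → ℝ, Continuous b ∧ StrictMono b ∧ b 0 = 0 ∧ ∀ s, 0 ≤ s → b (a s) = s := by
  obtain ⟨hc, hm, h0, hnn, htop⟩ := ha
  let g : ℝ → ℝ := fun s => a (max s 0) + min s 0
  have hg0 : ∀ s, 0 ≤ s → g s = a s := fun s hs => by simp [g, hs]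
  have hgneg : ∀ s, s ≤ 0 → g s = s := fun s hs => by simp [g, hs, h0]
  have hgc : Continuous g := by
    have : Continuous fun s : ℝ => a (max s 0) :=
      hc.comp_continuous (by fun_prop) fun s => le_max_right s 0
    exact this.add (by fun_prop)
  have hgm : StrictMono g := by
    intro s t hst
    rcases le_total 0 s with hs | hs
    · rw [hg0 s hs, hg0 t (hs.trans hst.le)]
      exact hm hs (show (0 : ℝ) ≤ t from hs.trans hst.le) hst
    · rcases le_total 0 t with ht | ht
      · rw [hgneg s hs, hg0 t ht]
        rcases hs.lt_or_eq with h | rfl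
        · exact h.trans_le (hnn t ht)
        · rw [← h0]
          exact hm (show (0 : ℝ) ≤ 0 from le_rfl) ht hst
      · rwa [hgneg s hs, hgneg t ht]
  have hsurj : Function.Surjective g := by
    refine hgc.surjective ?_ ?_
    · refine htop.congr' ?_
      filter_upwards [eventually_ge_atTop 0] with s hs
      rw [hg0 s hs]
    · refine tendsto_id.congr' ?_
      filter_upwards [eventually_le_atBot 0] with s hs
      rw [hgneg s hs, id]
  let e := hgm.orderIsoOfSurjective g hsurj
  have he : ∀ s, e.symm (g s) = s := fun s => e.symm_apply_apply s
  refine ⟨e.symm, e.symm.continuous, e.symm.strictMono, ?_, fun s hs => ?_⟩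
  · simpa [hgneg 0 le_rfl] using he 0
  · simpa [hg0 s hs] using he s

/-- The `KL` function obtained from a `K∞` comparison of the form `κ v * (1 + t) ≤ C * N s`. -/
lemma exists_KL_of_product {κ N : ℝ → ℝ} (hκ : IsKInf κ) {C : ℝ} (hC : 0 < C)
    (hNc : ContinuousOn N (Ici 0)) (hNm : StrictMonoOn N (Ici 0)) (hN0 : N 0 = 0) :
    ∃ σ, IsKL σ ∧ ∀ s t v, 0 ≤ t → 0 ≤ v → κ v * (1 + t) ≤ C * N s → v ≤ σ s t := by
  obtain ⟨b, hbc, hbm, hb0, hb⟩ := hκ.exists_inverse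
  have hNnn : ∀ s, 0 ≤ s → 0 ≤ N s := fun s hs => by
    rw [← hN0]
    exact hNm.monotoneOn (show (0 : ℝ) ≤ 0 from le_rfl) hs hs
  refine ⟨fun s t => b (C * N s / (1 + t)), ⟨?_, ?_, ?_, ?_, ?_⟩, ?_⟩
  · refine hbc.comp_continuousOn (ContinuousOn.div ?_ (by fun_prop) ?_)
    · exact continuousOn_const.mul (hNc.comp continuousOn_fst fun p hp => hp.1)
    · intro p hp
      have : (0 : ℝ) ≤ p.2 := hp.2
      positivity
  · intro s t hs ht
    rw [← hb0]
    have := hNnn s hs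
    exact hbm.monotone (by positivity)
  · intro t ht
    refine ⟨fun s hs s' hs' hss => hbm ?_, by simp [hN0, hb0]⟩
    have := hNm hs hs' hss
    gcongr
  · intro s hs t ht t' ht' htt
    have ht0 : (0 : ℝ) ≤ t := ht
    have := hNnn s hs
    refine hbm.monotone ?_
    gcongr
  · intro s hs
    have h : Tendsto (fun t : ℝ => C * N s / (1 + t)) atTop (nhds 0) :=
      tendsto_const_nhds.div_atTop (tendsto_atTop_add_const_left _ _ tendsto_id)
    simpa [hb0, Function.comp_def] using (hbc.tendsto 0).comp h
  · intro s t v ht hv h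
    rw [← hb v hv]
    refine hbm.monotone ?_
    rwa [le_div_iff₀ (by positivity)]

lemma MD.shift {l : ℕ} {D : Set (Euc l)} {d : ℝ → Euc l} (hd : MD l D d) {c : ℝ} (hc : 0 ≤ c) :
    MD l D (fun s => d (c + s)) := by
  obtain ⟨h1, h2, A, hA, h3⟩ := hd
  refine ⟨fun t ht => h1 _ (by linarith), fun t ht ε hε => ?_, (fun s => c + s) ⁻¹' A,
    fun C => ?_, fun t ht htA ε hε => ?_⟩
  · obtain ⟨δ, hδ, h⟩ := h2 (c + t) (by linarith) ε hε
    exact ⟨δ, hδ, fun s hs hst => h _ (by linarith) (by linarith)⟩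
  · refine ((hA (c + C)).preimage (add_right_injective c).injOn).subset fun s hs => ?_
    exact ⟨hs.1, by linarith [hs.2.1], by linarith [hs.2.2]⟩
  · obtain ⟨δ, hδ, h⟩ := h3 (c + t) (by linarith) htA ε hε
    refine ⟨δ, hδ, fun s hs hst => h _ (by linarith) ?_⟩
    rwa [add_sub_add_left_eq_sub]

/-- The decay estimate in product form. -/
lemma product_bound_of_decay {ρ q c : ℝ → ℝ} (hq : IsKInf q) (hpos : ∀ s, 0 < s → 0 < ρ s)
    (hc : ∀ M, 0 ≤ M → 0 < c M ∧ c M ≤ 1)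
    (hqc : ∀ w u M, 0 < w → w ≤ u → u ≤ M → q w * c M ≤ ρ u) {M m T W : ℝ}
    (hW : 0 ≤ W) (hM : 0 < M) (hmM : m < M)
    (hdecay : ∀ μ P, 0 < μ → μ < M → 0 ≤ P → (∀ u ∈ Icc μ M, P < ρ u) →
      W ≤ max μ (m - P * T)) :
    q (W / 2) * (1 + T) ≤ (2 * M + q M) / c M := by
  obtain ⟨hc0, hc1⟩ := hc M hM.le
  have hqM : 0 ≤ q M := hq.2.2.2.1 M hM.le
  rcases hW.eq_or_lt with rfl | hW
  · rw [zero_div, hq.2.2.1, zero_mul]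
    positivity
  have hWM : W ≤ M := by
    by_contra hlt
    have := hdecay (M / 2) 0 (by linarith) (by linarith) le_rfl
      fun u hu => hpos u (by linarith [hu.1])
    rcases le_max_iff.1 this with h | h <;> linarith
  have hq0 : 0 ≤ q (W / 2) := hq.2.2.2.1 _ (by linarith)
  have hqp : 0 < q (W / 2) := by
    rw [← hq.2.2.1]
    exact hq.2.1 (show (0 : ℝ) ≤ 0 from le_rfl) (show (0 : ℝ) ≤ W / 2 by linarith) (by linarith)
  have hqle : q (W / 2) ≤ q M :=
    hq.2.1.monotoneOn (show (0 : ℝ) ≤ W / 2 by linarith) hM.le (by linarith)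
  have key := hdecay (W / 2) (q (W / 2) * c M / 2) (by linarith) (by linarith) (by positivity)
    fun u hu => (half_lt_self (by positivity)).trans_le (hqc _ u M (by linarith) hu.1 hu.2)
  have hle : q (W / 2) * c M / 2 * T ≤ M := by
    rcases le_max_iff.1 key with h | h <;> linarith
  rw [le_div_iff₀ hc0]
  nlinarith

namespace LyapunovSetting

variable {n l : ℕ} {r τ : ℝ} {D : Set (Euc l)} {A : Set ℝ}
  {f : ℝ → (ℝ → Euc n) → Euc l → Euc n} {β : ℝ} {V : ℝ → (ℝ → Euc n) → ℝ} {a₁ : ℝ → ℝ}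
  {d : ℝ → Euc l} {x : ℝ → Euc n} {t₀ b : ℝ}

lemma decay_along (S : LyapunovSetting n l r τ D A f β V a₁) (hd : MD l D d)
    (hx : SolOn f d x t₀ b) (ht₀ : 0 ≤ t₀) {ρ : ℝ → ℝ} (hρ : ∀ s, 0 ≤ s → 0 ≤ ρ s)
    (hdecr : ∀ t x d, τ ≤ t → ContinuousOn x (Icc (-(r + τ)) 0) → d ∈ D →
      (∃ dd : ℝ → Euc l, MD l D dd ∧ ∀ θ ∈ Icc (-τ) 0,
        x θ = x (-τ) + ∫ s in (-τ)..θ, f (t + s) (fun θ' => x (s + θ')) (dd (τ + s))) →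
      Vdot n (r + τ) V t x (f t x d) ≤ ((-(ρ (V t x)) : ℝ) : EReal))
    {μ M P : ℝ} (hP : 0 ≤ P) (hPρ : ∀ u ∈ Icc μ M, P < ρ u) (hμM : μ < M)
    (hwM : V (t₀ + τ) (seg x (t₀ + τ)) < M) :
    ∀ t ∈ Icc (t₀ + τ) b,
      V t (seg x t) ≤ max μ (V (t₀ + τ) (seg x (t₀ + τ)) - P * (t - (t₀ + τ))) := by
  have hτ := S.hτ
  have ha : 0 ≤ t₀ + τ := add_nonneg ht₀ hτ
  have hx' : SolOn f d x (t₀ + τ) b := hx.mono (by linarith) le_rfl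
  refine decay (w := fun t => V t (seg x t)) S.hA ha ?_ ?_
    (fun t ht => S.local_growth hd hx' ha ht.1 ht.2)
    (fun t ht => hρ _ (S.nonneg_along hx.1 (ha.trans ht.1))) hP hPρ hμM hwM
  · intro t ht ε hε
    obtain ⟨δ, hδ, h⟩ := S.lsc_along hx.1 (ha.trans ht.1) hε
    exact ⟨δ, hδ, fun s hs hst => h s (ha.trans hs.1) hst⟩
  · intro t ht htA c hc
    have ht0 : 0 ≤ t := ha.trans ht.1
    have htτ : 0 ≤ t - τ := by linarith [ht.1]
    refine S.step_along hd hx' ha ht.1 ht.2 htA ((hdecr t (seg x t) (d t) (by linarith)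
      (continuous_seg hx.1 t).continuousOn (hd.1 t ht0)
      ⟨fun s => d (t - τ + s), hd.shift htτ, fun θ hθ => ?_⟩).trans_lt
        (EReal.coe_lt_coe_iff.2 hc))
    have e := hx.2 (t + -τ) (t + θ) (by linarith [ht.1]) (by linarith [hθ.1])
      (by linarith [hθ.2, ht.2])
    rw [← intervalIntegral.integral_comp_add_left (fun u => f u (seg x u) (d u)) t] at e
    refine e.trans ?_
    congr 1
    refine intervalIntegral.integral_congr fun s _ => ?_
    have e1 : t - τ + (τ + s) = t + s := by ring
    have e2 : seg x (t + s) = fun θ' => x (t + (s + θ')) := funext fun θ' => by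
      rw [← add_assoc]
    simp only [e1, e2]

/-- Every initial history extends to a global solution. -/
lemma exists_global (S : LyapunovSetting n l r τ D A f β V a₁) (hd : MD l D d)
    {φ : ℝ → Euc n} (hφ : Continuous φ) (ht₀ : 0 ≤ t₀) :
    ∃ x, IsSolGlobal n l r f d t₀ x ∧ ∀ t ≤ t₀, x t = φ t := by
  have hex : ∀ k : ℕ, ∃ x, SolOn f d x t₀ (t₀ + k) ∧ ∀ t ≤ t₀, x t = φ t := fun k =>
    S.exists_solOn hd hφ ht₀ (by linarith [Nat.cast_nonneg (α := ℝ) k])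
  choose X hX hXφ using hex
  have hagree : ∀ (j k : ℕ) (s : ℝ), s ≤ t₀ + j → s ≤ t₀ + k → X j s = X k s := by
    intro j k s hj hk
    rcases le_total s t₀ with hs | hs
    · rw [hXφ j s hs, hXφ k s hs]
    · exact S.unique hd ht₀ ((hX j).mono le_rfl hj) ((hX k).mono le_rfl hk)
        (fun u hu => by rw [hXφ j u hu.2, hXφ k u hu.2]) s ⟨hs, le_rfl⟩
  let x : ℝ → Euc n := fun s => X ⌈s - t₀⌉₊ s
  have hxX : ∀ (k : ℕ) (s : ℝ), s ≤ t₀ + k → x s = X k s := fun k s hs =>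
    hagree _ k s (by linarith [Nat.le_ceil (s - t₀)]) hs
  have hxc : Continuous x := by
    refine continuous_iff_continuousAt.2 fun s => ?_
    obtain ⟨k, hk⟩ := exists_nat_gt (s - t₀)
    refine (hX k).1.continuousAt.congr ?_
    filter_upwards [gt_mem_nhds (show s < t₀ + k by linarith)] with u hu
    exact (hxX k u hu.le).symm
  refine ⟨x, ⟨hxc.continuousOn, fun t ht =>
    ⟨rhs_intervalIntegrable S.hr S.hA S.hf S.h2 hd hxc ht₀ ht, ?_⟩⟩, fun t ht => ?_⟩
  · obtain ⟨k, hk⟩ := exists_nat_gt (t - t₀)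
    rw [hxX k t (by linarith), hxX k t₀ (by linarith [Nat.cast_nonneg (α := ℝ) k]),
      (hX k).2 t₀ t le_rfl ht (by linarith)]
    congr 1
    refine intervalIntegral.integral_congr fun s hs => ?_
    rw [uIcc_of_le ht] at hs
    refine S.hloc s _ _ _ (ht₀.trans hs.1) (continuous_seg (hX k).1 s).continuousOn
      (hd.1 s (ht₀.trans hs.1)) fun θ hθ => ?_
    exact (hxX k _ (by linarith [hs.2, hθ.2])).symm
  · rw [hxX 0 t (by simpa using ht), hXφ 0 t ht]

/-- A global solution, frozen to the left of its initial interval, solves the equation on every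
compact interval. -/
lemma solOn_of_global (S : LyapunovSetting n l r τ D A f β V a₁) (hd : MD l D d) (ht₀ : 0 ≤ t₀)
    (hx : IsSolGlobal n l r f d t₀ x) (b : ℝ) :
    SolOn f d (fun s => x (max s (t₀ - r))) t₀ b := by
  have hr := S.hr
  have hc : Continuous fun s => x (max s (t₀ - r)) :=
    hx.1.comp_continuous (by fun_prop) fun s => mem_Ici.2 (le_max_right _ _)
  refine SolOn.of_initial hr S.hA S.hf S.h2 hd hc ht₀ fun t ht => ?_
  have e : ∀ s, t₀ - r ≤ s → x (max s (t₀ - r)) = x s := fun s hs => by rw [max_eq_left hs]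
  show x (max t (t₀ - r)) = x (max t₀ (t₀ - r)) + _
  rw [e t (by linarith [ht.1]), e t₀ (by linarith), (hx.2 t ht.1).2]
  congr 1
  refine intervalIntegral.integral_congr fun s hs => ?_
  rw [uIcc_of_le ht.1] at hs
  refine (S.hloc s _ _ _ (ht₀.trans hs.1) (continuous_seg hc s).continuousOn
    (hd.1 s (ht₀.trans hs.1)) fun θ hθ => ?_).symm
  exact e _ (by linarith [hs.1, hθ.1])

end LyapunovSetting

/-- The gain in the `KL` estimate: `M ↦ (2 * M + q M) / c M` is continuous and
strictly increasing. -/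
lemma strictMonoOn_quotient {q c : ℝ → ℝ} (hq : IsKInf q) (hc : ContinuousOn c (Ici 0))
    (hca : AntitoneOn c (Ici 0)) (hcp : ∀ M, 0 ≤ M → 0 < c M) :
    ContinuousOn (fun M => (2 * M + q M) / c M) (Ici 0) ∧
      StrictMonoOn (fun M => (2 * M + q M) / c M) (Ici 0) := by
  refine ⟨ContinuousOn.div (ContinuousOn.add (by fun_prop) hq.1) hc fun M hM => (hcp M hM).ne', ?_⟩
  intro M hM M' hM' hlt
  have hM0 : (0 : ℝ) ≤ M := hM
  refine div_lt_div₀ ?_ (hca hM hM' hlt.le) ?_ (hcp M' hM')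
  · linarith [hq.2.1 hM hM' hlt]
  · have := hq.2.2.2.1 M' hM'
    linarith

/-- **Theorem 2.10, (c) ⇒ (a).** Under hypotheses (H1)-(H4), the existence
of a lower semicontinuous functional `V` on `[0,∞) × C([-r-τ,0];ℝⁿ)` with uniform bounds
(2.20), the growth condition (2.21a) everywhere and the infinitesimal decrease property
(2.21b) on the sets `S(t)`, implies that `0` is URGAS. -/
theorem stmt11 (n l : ℕ) (r τ : ℝ) (hr : 0 ≤ r) (hτ : 0 ≤ τ)
    (D : Set (Euc l)) (hD : D.Nonempty)
    (f : ℝ → (ℝ → Euc n) → Euc l → Euc n)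
    (hf0 : ∀ t d, 0 ≤ t → d ∈ D → f t (fun _ => (0 : Euc n)) d = 0)
    (h1 : H1 n l r D f) (h2 : H2 n l r D f) (h3 : H3 n l r D f) (h4 : H4 n l r D f)
    (β : ℝ) (hβ : 0 ≤ β)
    (V : ℝ → (ℝ → Euc n) → ℝ)
    (hVnn : ∀ t x, 0 ≤ t → ContinuousOn x (Icc (-(r + τ)) 0) → 0 ≤ V t x)
    (hVlsc : ∀ t x, 0 ≤ t → ContinuousOn x (Icc (-(r + τ)) 0) → ∀ ε > 0, ∃ δ > 0,
      ∀ t' x', 0 ≤ t' → ContinuousOn x' (Icc (-(r + τ)) 0) →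
        |t' - t| + histNorm n (r + τ) (x' - x) < δ → V t x - ε < V t' x')
    (a₁ a₂ : ℝ → ℝ) (ha₁ : IsKInf a₁) (ha₂ : IsKInf a₂)
    (ρ : ℝ → ℝ) (hρ0 : ρ 0 = 0) (hρpos : ∀ s, 0 < s → 0 < ρ s)
    (hρlip : ∀ Rl : ℝ, 0 ≤ Rl → ∃ K : NNReal, LipschitzOnWith K ρ (Icc 0 Rl))
    (hbound : ∀ t x, 0 ≤ t → ContinuousOn x (Icc (-(r + τ)) 0) →
      a₁ ‖x 0‖ ≤ V t x ∧ V t x ≤ a₂ (histNorm n (r + τ) x))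
    (hdecr1 : ∀ t x d, 0 ≤ t → ContinuousOn x (Icc (-(r + τ)) 0) → d ∈ D →
      Vdot n (r + τ) V t x (f t x d) ≤ ((β * V t x : ℝ) : EReal))
    (hdecr2 : ∀ t x d, τ ≤ t → ContinuousOn x (Icc (-(r + τ)) 0) → d ∈ D →
      (∃ dd : ℝ → Euc l, MD l D dd ∧ ∀ θ ∈ Icc (-τ) 0,
        x θ = x (-τ) + ∫ s in (-τ)..θ, f (t + s) (fun θ' => x (s + θ')) (dd (τ + s))) →
      Vdot n (r + τ) V t x (f t x d) ≤ ((-(ρ (V t x)) : ℝ) : EReal)) :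
    URGAS n l r D f := by
  obtain ⟨A, hA, hf, hloc⟩ := H3.exists_contOff hr h3
  have S : LyapunovSetting n l r τ D A f β V a₁ :=
    ⟨hr, hτ, hA, hf, hloc, h1, h2, hβ, hVnn, hVlsc, ha₁, fun t x ht hx => (hbound t x ht hx).1,
      hdecr1⟩
  have hρc : Continuous fun s => ρ (max s 0) := by
    have : ContinuousOn ρ (Ici 0) := by
      intro s hs
      obtain ⟨K, hK⟩ := hρlip (s + 1) (by linarith [mem_Ici.1 hs])
      refine (hK.continuousOn s ⟨hs, by linarith⟩).mono_of_mem_nhdsWithin ?_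
      filter_upwards [self_mem_nhdsWithin,
        mem_nhdsWithin_of_mem_nhds (Iio_mem_nhds (lt_add_one s))] with u hu hu'
      exact ⟨hu, le_of_lt hu'⟩
    exact this.comp_continuous (by fun_prop) fun s => mem_Ici.2 (le_max_right _ _)
  have hρnn : ∀ s, 0 ≤ s → 0 ≤ ρ s := fun s hs => by
    rcases hs.eq_or_lt with rfl | h
    · exact hρ0.ge
    · exact (hρpos s h).le
  obtain ⟨q, c, hq, hcc, hca, hc, hqc⟩ := exists_product_minorant hρc
    (fun s hs => hρnn _ (le_max_right _ _))
    (fun s hs => hρpos _ (hs.trans_le (le_max_left _ _)))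
  replace hqc : ∀ w u M, 0 < w → w ≤ u → u ≤ M → q w * c M ≤ ρ u := fun w u M hw hwu huM => by
    simpa [max_eq_left (hw.le.trans hwu)] using hqc w u M hw hwu huM
  obtain ⟨hQc, hQm⟩ := strictMonoOn_quotient hq hcc hca fun M hM => (hc M hM).1
  let E := Real.exp ((β + 1) * τ)
  have hE : 0 < E := Real.exp_pos _
  let Mf : ℝ → ℝ := fun s => 2 * (E * a₂ s + a₁ s)
  have hMf0 : ∀ s, 0 ≤ s → 0 ≤ Mf s := fun s hs => by
    have := ha₁.2.2.2.1 s hs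
    have := ha₂.2.2.2.1 s hs
    positivity
  have hMfm : StrictMonoOn Mf (Ici 0) := fun s hs t ht hst => by
    have e1 := ha₁.2.1 hs ht hst
    have e2 := mul_lt_mul_of_pos_left (ha₂.2.1 hs ht hst) hE
    simp only [Mf]
    linarith
  have hMfc : ContinuousOn Mf (Ici 0) :=
    continuousOn_const.mul ((continuousOn_const.mul ha₂.1).add ha₁.1)
  have hMfz : Mf 0 = 0 := by simp [Mf, ha₁.2.2.1, ha₂.2.2.1]
  let Q : ℝ → ℝ := fun M => (2 * M + q M) / c M
  have hQ0 : Q 0 = 0 := by simp [Q, hq.2.2.1]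
  have hqQ : ∀ v M, 0 ≤ v → v ≤ M → q v ≤ Q M := fun v M hv hvM => by
    obtain ⟨hc0, hc1⟩ := hc M (hv.trans hvM)
    have e1 := hq.2.1.monotoneOn (mem_Ici.2 hv) (mem_Ici.2 (hv.trans hvM)) hvM
    have e2 := hq.2.2.2.1 v hv
    simp only [Q]
    rw [le_div_iff₀ hc0]
    nlinarith
  have hκ : IsKInf fun v => q (a₁ v / 2) := by
    have hnn : ∀ v, 0 ≤ v → 0 ≤ a₁ v / 2 := fun v hv => div_nonneg (ha₁.2.2.2.1 v hv) zero_le_two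
    refine ⟨hq.1.comp (ha₁.1.div_const 2) fun v hv => hnn v hv, fun v hv w hw hvw => ?_,
      by simp [ha₁.2.2.1, hq.2.2.1], fun v hv => hq.2.2.2.1 _ (hnn v hv),
      hq.2.2.2.2.comp (ha₁.2.2.2.2.atTop_div_const two_pos)⟩
    exact hq.2.1 (hnn v hv) (hnn w hw) (by linarith [ha₁.2.1 hv hw hvw])
  obtain ⟨σ, hσ, hle⟩ := exists_KL_of_product hκ (N := Q ∘ Mf) (C := 1 + r + τ) (by positivity)
    (hQc.comp hMfc fun s hs => hMf0 s hs)
    (fun s hs t ht hst => hQm (hMf0 s hs) (hMf0 t ht) (hMfm hs ht hst))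
    (by simp [hMfz, hQ0])
  refine ⟨σ, hσ, fun t₀ x₀ d ht₀ hx₀ hd => ?_, fun t₀ x₀ d x ht₀ hx₀ hd hx hxx₀ t ht => ?_⟩
  · have hφ : Continuous fun s => x₀ (max (-r) (min (s - t₀) 0)) :=
      hx₀.comp_continuous (by fun_prop) fun s =>
        ⟨le_max_left _ _, max_le (by linarith) (min_le_right _ _)⟩
    obtain ⟨x, hx, hxφ⟩ := S.exists_global hd hφ ht₀
    refine ⟨x, hx, fun θ hθ => ?_⟩
    rw [hxφ _ (by linarith [hθ.2]), add_sub_cancel_left, min_eq_left hθ.2, max_eq_right hθ.1]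
  let y : ℝ → Euc n := fun s => x (max s (t₀ - r))
  have hy : ∀ b, SolOn f d y t₀ b := S.solOn_of_global hd ht₀ hx
  have hyc : Continuous y := (hy t₀).1
  have hyx : ∀ s, t₀ - r ≤ s → y s = x s := fun s hs => by simp only [y, max_eq_left hs]
  set s₀ := histNorm n r x₀ with hs₀
  have hs₀0 : 0 ≤ s₀ := histNorm_nonneg _
  have hhist : ∀ s ≤ t₀, ‖y s‖ ≤ s₀ := fun s hs => by
    have hmem : max s (t₀ - r) - t₀ ∈ Icc (-r) 0 :=
      ⟨by linarith [le_max_right s (t₀ - r)], by linarith [max_le hs (by linarith : t₀ - r ≤ t₀)]⟩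
    have e := hxx₀ _ hmem
    rw [add_sub_cancel] at e
    simp only [y]
    rw [e]
    exact norm_le_histNorm hx₀ hmem
  have hV₀ : V t₀ (seg y t₀) ≤ a₂ s₀ := by
    refine (hbound t₀ _ ht₀ (continuous_seg hyc t₀).continuousOn).2.trans ?_
    refine ha₂.2.1.monotoneOn (mem_Ici.2 (histNorm_nonneg _)) hs₀0 ?_
    exact histNorm_le (add_nonneg hr hτ) fun θ hθ => hhist _ (by linarith [hθ.2])
  have ha₁s := ha₁.2.2.2.1 s₀ hs₀0
  have ha₂s := ha₂.2.2.2.1 s₀ hs₀0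
  have hgrow : ∀ s, t₀ ≤ s → V s (seg y s) ≤ Real.exp ((β + 1) * (s - t₀)) * a₂ s₀ := fun s hs =>
    (S.growth hd (hy s) ht₀ s ⟨hs, le_rfl⟩).trans
      (mul_le_mul_of_nonneg_left hV₀ (Real.exp_pos _).le)
  have hearly : ∀ s, t₀ ≤ s → s ≤ t₀ + τ → V s (seg y s) ≤ E * a₂ s₀ := fun s hs hs' =>
    (hgrow s hs).trans (mul_le_mul_of_nonneg_right
      (Real.exp_le_exp.2 (mul_le_mul_of_nonneg_left (by linarith) (by linarith))) ha₂s)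
  have hlate : ∀ s, t₀ + τ ≤ s → q (V s (seg y s) / 2) * (1 + (s - (t₀ + τ))) ≤ Q (Mf s₀) := by
    intro s hs
    have hVs := S.nonneg_along hyc (by linarith : 0 ≤ s)
    rcases hs₀0.eq_or_lt with h0 | hpos
    · have hz : V s (seg y s) = 0 := le_antisymm (by
        have := hgrow s (by linarith)
        rwa [← h0, ha₂.2.2.1, mul_zero] at this) hVs
      rw [hz, zero_div, hq.2.2.1, zero_mul, ← h0, hMfz, hQ0]
    · have ha₂p : 0 < a₂ s₀ := by
        rw [← ha₂.2.2.1]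
        exact ha₂.2.1 (mem_Ici.2 le_rfl) hs₀0 hpos
      have hEa := mul_pos hE ha₂p
      have hlt : V (t₀ + τ) (seg y (t₀ + τ)) < Mf s₀ := by
        refine (hearly _ (by linarith) le_rfl).trans_lt ?_
        simp only [Mf]
        linarith
      refine product_bound_of_decay hq hρpos hc hqc hVs (by simp only [Mf]; linarith) hlt ?_
      intro μ P hμ hμM hP hPρ
      exact S.decay_along hd (hy s) ht₀ hρnn hdecr2 hP hPρ hμM hlt s ⟨hs, le_rfl⟩
  refine histNorm_le hr fun θ hθ => ?_
  have hst : t₀ - r ≤ t + θ := by linarith [hθ.1]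
  rw [← hyx _ hst]
  refine hle _ _ _ (by linarith) (norm_nonneg _) ?_
  set s := t + θ with hs
  have hyn := ha₁.2.2.2.1 _ (norm_nonneg (y s))
  show q (a₁ ‖y s‖ / 2) * (1 + (t - t₀)) ≤ (1 + r + τ) * Q (Mf s₀)
  have hhalf : 0 ≤ a₁ ‖y s‖ / 2 := div_nonneg hyn zero_le_two
  have hqn := hq.2.2.2.1 _ hhalf
  rcases le_total (t₀ + τ) s with h | h
  · have e1 := S.lower_along hyc (by linarith : 0 ≤ s)
    have e2 : q (a₁ ‖y s‖ / 2) ≤ q (V s (seg y s) / 2) :=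
      hq.2.1.monotoneOn (mem_Ici.2 hhalf) (mem_Ici.2 (by linarith)) (by linarith)
    have e3 := (mul_le_mul_of_nonneg_right e2
      (by linarith : 0 ≤ 1 + (s - (t₀ + τ)))).trans (hlate s h)
    have e4 : 1 + (t - t₀) ≤ (1 + r + τ) * (1 + (s - (t₀ + τ))) := by
      nlinarith [hθ.1, mul_nonneg (add_nonneg hr hτ) (sub_nonneg.2 h)]
    calc q (a₁ ‖y s‖ / 2) * (1 + (t - t₀))
        ≤ q (a₁ ‖y s‖ / 2) * ((1 + r + τ) * (1 + (s - (t₀ + τ)))) :=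
          mul_le_mul_of_nonneg_left e4 hqn
      _ = (1 + r + τ) * (q (a₁ ‖y s‖ / 2) * (1 + (s - (t₀ + τ)))) := by ring
      _ ≤ _ := mul_le_mul_of_nonneg_left e3 (by positivity)
  · have e1 : a₁ ‖y s‖ ≤ E * a₂ s₀ + a₁ s₀ := by
      rcases le_total s t₀ with h' | h'
      · have := ha₁.2.1.monotoneOn (mem_Ici.2 (norm_nonneg (y s))) hs₀0 (hhist s h')
        linarith [mul_nonneg hE.le ha₂s]
      · linarith [S.lower_along hyc (by linarith : 0 ≤ s), hearly s h' h]
    have e2 : q (a₁ ‖y s‖ / 2) ≤ Q (Mf s₀) :=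
      hqQ _ _ hhalf (by simp only [Mf]; linarith)
    rw [mul_comm (1 + r + τ)]
    exact mul_le_mul e2 (by linarith [hθ.1]) (by linarith) (hqn.trans e2)

end
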